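/- arXiv:2411.17929 — 2 statements merged into one kernel-verified Lean document; each statement's English description precedes it below -/
import Mathlib

section
/- Let Ū ∈ C_c^∞(ℝ³;ℝ³) be divergence-free, set ū(x,t) := t^{-1/2}·Ū(x/√t), and let θ be an admissible solution on [1,∞) of ∂ₜθ = Δθ − ū·∇θ. Then for every integer k ≥ 1 there exists a constant C = C(k, Ū) such that for all t > 1: ‖∇^{k−1}θ(·,t)‖²_{L²(ℝ³)} + ∫₁^t ‖∇^k θ(·,s)‖²_{L²(ℝ³)} ds ≤ C·( ‖∇^{k−1}θ(·,1)‖²_{L²(ℝ³)} + ∫₁^t ‖θ(·,s)‖²_{H^{k−1}} ds ). -/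
noncomputable section

open MeasureTheory
open scoped ENNReal BigOperators

/-- Three-dimensional Euclidean space. -/
abbrev E3 : Type := EuclideanSpace ℝ (Fin 3)

/-- Spatial partial derivative `∂ᵢ F` of a scalar function. -/
noncomputable def pd (F : E3 → ℝ) (i : Fin 3) (x : E3) : ℝ :=
  fderiv ℝ F x (EuclideanSpace.single i 1)

/-- Laplacian `ΔF` of a scalar function. -/
noncomputable def lap (F : E3 → ℝ) (x : E3) : ℝ :=
  ∑ i, pd (fun y => pd F i y) i x

/-- Spatial divergence `∇·u` of a vector field. -/
noncomputable def divg (u : E3 → E3) (x : E3) : ℝ :=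
  ∑ i, pd (fun y => u y i) i x

/-- The self-similar velocity field `ū(x,t) = t^{-1/2} Ū(x/√t)`. -/
noncomputable def ubar (Ubar : E3 → E3) (x : E3) (t : ℝ) : E3 :=
  (t ^ (-(1:ℝ)/2)) • Ubar ((t ^ (-(1:ℝ)/2)) • x)

/-- The squared Sobolev `H^m` norm `∑_{j=0}^m ∫ ‖∇ʲ g‖²`. -/
noncomputable def sobSq (m : ℕ) (g : E3 → ℝ) : ℝ :=
  ∑ j ∈ Finset.range (m + 1), ∫ x : E3, ‖iteratedFDeriv ℝ j g x‖ ^ 2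

/-- `θ` is an admissible solution on `ℝ³ × [1,∞)` of the advected heat equation
`∂ₜθ = Δθ − ū·∇θ`: it is smooth, solves the equation pointwise, and together with all
its spatial derivatives decays in `x` faster than any polynomial, locally uniformly
in `t`. -/
def IsAdmissible (Ubar : E3 → E3) (θ : E3 → ℝ → ℝ) : Prop :=
  ContDiffOn ℝ (⊤ : ℕ∞) (fun q : E3 × ℝ => θ q.1 q.2) {q : E3 × ℝ | 1 ≤ q.2} ∧
  (∀ (x : E3) (t : ℝ), 1 ≤ t →
    deriv (fun s => θ x s) t
      = lap (fun y => θ y t) x - ∑ i, ubar Ubar x t i * pd (fun y => θ y t) i x) ∧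
  (∀ (n k : ℕ) (T : ℝ), ∃ C : ℝ, ∀ (x : E3) (t : ℝ), 1 ≤ t → t ≤ T →
    ‖x‖ ^ n * ‖iteratedFDeriv ℝ k (fun y => θ y t) x‖ ≤ C)

lemma minSmoothness_two_le : minSmoothness ℝ 2 ≤ ((⊤ : ℕ∞) : WithTop ℕ∞) := by
  rw [minSmoothness_of_isRCLikeNormedField]
  exact WithTop.coe_le_coe.2 (le_top : (2 : ℕ∞) ≤ ⊤)

/-- The mixed partial derivative `∂_{v 0} ⋯ ∂_{v (n-1)} f`. -/
def mixedPD {n : ℕ} (v : Fin n → Fin 3) (f : E3 → ℝ) (x : E3) : ℝ :=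
  iteratedFDeriv ℝ n f x (fun j => EuclideanSpace.single (v j) 1)

lemma abs_mixedPD_le {n : ℕ} (v : Fin n → Fin 3) (f : E3 → ℝ) (x : E3) :
    |mixedPD v f x| ≤ ‖iteratedFDeriv ℝ n f x‖ := by
  simpa [mixedPD] using
    (iteratedFDeriv ℝ n f x).le_opNorm (fun j => EuclideanSpace.single (v j) (1 : ℝ))

lemma norm_iteratedFDeriv_le_sum_mixedPD (n : ℕ) (f : E3 → ℝ) (x : E3) :
    ‖iteratedFDeriv ℝ n f x‖ ≤ ∑ v : Fin n → Fin 3, |mixedPD v f x| := by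
  refine ContinuousMultilinearMap.opNorm_le_bound
    (Finset.sum_nonneg fun _ _ => abs_nonneg _) fun m => ?_
  have hm : m = fun j => ∑ i : Fin 3, m j i • EuclideanSpace.single i (1 : ℝ) := by
    funext j
    ext i
    fin_cases i <;> simp [Fin.sum_univ_three]
  conv_lhs => rw [hm, ContinuousMultilinearMap.map_sum]
  rw [Finset.sum_mul]
  refine (norm_sum_le _ _).trans (Finset.sum_le_sum fun v _ => ?_)
  rw [ContinuousMultilinearMap.map_smul_univ, norm_smul, mul_comm, norm_prod]
  refine mul_le_mul_of_nonneg_left ?_ (abs_nonneg _)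
  exact Finset.prod_le_prod (fun _ _ => norm_nonneg _) fun j _ => PiLp.norm_apply_le (m j) (v j)

lemma sq_norm_iteratedFDeriv_le (n : ℕ) (f : E3 → ℝ) (x : E3) :
    ‖iteratedFDeriv ℝ n f x‖ ^ 2 ≤ 3 ^ n * ∑ v : Fin n → Fin 3, mixedPD v f x ^ 2 := by
  calc ‖iteratedFDeriv ℝ n f x‖ ^ 2 ≤ (∑ v : Fin n → Fin 3, |mixedPD v f x|) ^ 2 := by
        gcongr
        exact norm_iteratedFDeriv_le_sum_mixedPD n f x
    _ ≤ _ := by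
        have := sq_sum_le_card_mul_sum_sq (s := (Finset.univ : Finset (Fin n → Fin 3)))
          (f := fun v => |mixedPD v f x|)
        simpa using this

lemma sum_sq_mixedPD_le (n : ℕ) (f : E3 → ℝ) (x : E3) :
    ∑ v : Fin n → Fin 3, mixedPD v f x ^ 2 ≤ 3 ^ n * ‖iteratedFDeriv ℝ n f x‖ ^ 2 := by
  calc ∑ v : Fin n → Fin 3, mixedPD v f x ^ 2
      ≤ ∑ _v : Fin n → Fin 3, ‖iteratedFDeriv ℝ n f x‖ ^ 2 :=
        Finset.sum_le_sum fun v _ => by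
          rw [← sq_abs]
          gcongr
          exact abs_mixedPD_le v f x
    _ = _ := by simp

lemma pd_mixedPD {n : ℕ} (v : Fin n → Fin 3) (i : Fin 3) {f : E3 → ℝ}
    (hf : ContDiff ℝ (⊤ : ℕ∞) f) (x : E3) :
    pd (mixedPD v f) i x = mixedPD (Fin.cons i v : Fin (n + 1) → Fin 3) f x := by
  have hd : DifferentiableAt ℝ (iteratedFDeriv ℝ n f) x :=
    (hf.differentiable_iteratedFDeriv (by exact_mod_cast WithTop.coe_lt_top n)) x
  have h := ((ContinuousMultilinearMap.apply ℝ (fun _ : Fin n => E3) ℝ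
    (fun j => EuclideanSpace.single (v j) (1 : ℝ))).hasFDerivAt.comp x hd.hasFDerivAt).fderiv
  unfold pd mixedPD
  rw [iteratedFDeriv_succ_apply_left]
  exact (congrArg (fun L => L (EuclideanSpace.single i (1 : ℝ))) h).trans
    (by simp; rfl)

lemma contDiff_mixedPD {n : ℕ} (v : Fin n → Fin 3) {f : E3 → ℝ}
    (hf : ContDiff ℝ (⊤ : ℕ∞) f) : ContDiff ℝ (⊤ : ℕ∞) (mixedPD v f) :=
  (ContinuousMultilinearMap.apply ℝ (fun _ : Fin n => E3) ℝ
    (fun j => EuclideanSpace.single (v j) (1 : ℝ))).contDiff.comp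
    (hf.iteratedFDeriv_right (m := (⊤ : ℕ∞)) (i := n) (by exact_mod_cast le_top))

lemma contDiff_pd (i : Fin 3) {f : E3 → ℝ} (hf : ContDiff ℝ (⊤ : ℕ∞) f) :
    ContDiff ℝ (⊤ : ℕ∞) (pd f i) :=
  (hf.fderiv_right (m := (⊤ : ℕ∞)) (by exact_mod_cast le_top)).clm_apply contDiff_const

lemma pd_comm (i j : Fin 3) {f : E3 → ℝ} (hf : ContDiff ℝ (⊤ : ℕ∞) f) (x : E3) :
    pd (pd f i) j x = pd (pd f j) i x := by
  have hd : Differentiable ℝ (fderiv ℝ f) :=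
    (hf.fderiv_right (m := (⊤ : ℕ∞)) (by exact_mod_cast le_top)).differentiable (by simp)
  have key (i j : Fin 3) : pd (pd f i) j x = fderiv ℝ (fderiv ℝ f) x
      (EuclideanSpace.single j 1) (EuclideanSpace.single i 1) := by
    unfold pd
    rw [fderiv_clm_apply (hd x) (differentiableAt_const _)]
    simp
  rw [key, key]
  exact (hf.contDiffAt.isSymmSndFDerivAt minSmoothness_two_le) _ _

lemma mixedPD_pd {n : ℕ} (v : Fin n → Fin 3) (i : Fin 3) {f : E3 → ℝ}
    (hf : ContDiff ℝ (⊤ : ℕ∞) f) : mixedPD v (pd f i) = pd (mixedPD v f) i := by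
  induction n with
  | zero =>
    have (g : E3 → ℝ) : mixedPD v g = g := by
      funext x
      simp [mixedPD]
    rw [this, this]
  | succ n ih =>
    funext x
    have (g : E3 → ℝ) (hg : ContDiff ℝ (⊤ : ℕ∞) g) :
        mixedPD v g = pd (mixedPD (Fin.tail v) g) (v 0) := by
      funext y
      rw [pd_mixedPD _ _ hg, Fin.cons_self_tail]
    rw [this _ (contDiff_pd i hf), ih, this f hf, pd_comm _ _ (contDiff_mixedPD _ hf)]

lemma mixedPD_sum {ι : Type*} (s : Finset ι) {n : ℕ} (v : Fin n → Fin 3) {f : ι → E3 → ℝ}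
    (hf : ∀ j ∈ s, ContDiff ℝ (⊤ : ℕ∞) (f j)) (x : E3) :
    mixedPD v (fun y => ∑ j ∈ s, f j y) x = ∑ j ∈ s, mixedPD v (f j) x := by
  unfold mixedPD
  rw [iteratedFDeriv_sum fun j hj => (hf j hj).of_le (by exact_mod_cast le_top)]
  simp

lemma mixedPD_sub {n : ℕ} (v : Fin n → Fin 3) {f g : E3 → ℝ}
    (hf : ContDiff ℝ (⊤ : ℕ∞) f) (hg : ContDiff ℝ (⊤ : ℕ∞) g) (x : E3) :
    mixedPD v (fun y => f y - g y) x = mixedPD v f x - mixedPD v g x := by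
  unfold mixedPD
  have := iteratedFDeriv_sub_apply (𝕜 := ℝ) (i := n) (x := x)
    (hf.of_le (by exact_mod_cast le_top)).contDiffAt (hg.of_le (by exact_mod_cast le_top)).contDiffAt
  change iteratedFDeriv ℝ n (f - g) x _ = _
  rw [this]
  rfl

lemma mixedPD_lap {n : ℕ} (v : Fin n → Fin 3) {f : E3 → ℝ}
    (hf : ContDiff ℝ (⊤ : ℕ∞) f) (x : E3) :
    mixedPD v (lap f) x = ∑ i, pd (pd (mixedPD v f) i) i x := by
  unfold lap
  rw [mixedPD_sum _ _ fun i _ => contDiff_pd i (contDiff_pd i hf)]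
  refine Finset.sum_congr rfl fun i _ => ?_
  rw [mixedPD_pd _ _ (contDiff_pd i hf), mixedPD_pd _ _ hf]

lemma contDiff_lap {f : E3 → ℝ} (hf : ContDiff ℝ (⊤ : ℕ∞) f) : ContDiff ℝ (⊤ : ℕ∞) (lap f) :=
  ContDiff.sum fun i _ => contDiff_pd i (contDiff_pd i hf)

lemma norm_iteratedFDeriv_pd_le (n : ℕ) (i : Fin 3) {f : E3 → ℝ}
    (hf : ContDiff ℝ (⊤ : ℕ∞) f) (x : E3) :
    ‖iteratedFDeriv ℝ n (pd f i) x‖ ≤ ‖iteratedFDeriv ℝ (n + 1) f x‖ := by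
  have h := norm_iteratedFDeriv_clm_apply_const (𝕜 := ℝ) (n := n) (x := x) (N := (⊤ : ℕ∞))
    (c := (EuclideanSpace.single i 1 : E3))
    (hf.fderiv_right (m := (⊤ : ℕ∞)) (by exact_mod_cast le_top)).contDiffAt
    (by exact_mod_cast le_top)
  rw [norm_iteratedFDeriv_fderiv, PiLp.norm_single, norm_one, one_mul] at h
  exact h

/-- The advection term `∑ᵢ ūᵢ(·,t) ∂ᵢf`. -/
def advection (Ubar : E3 → E3) (t : ℝ) (f : E3 → ℝ) (y : E3) : ℝ :=
  ∑ i, ubar Ubar y t i * pd f i y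

lemma contDiff_ubar {Ubar : E3 → E3} (hU : ContDiff ℝ (⊤ : ℕ∞) Ubar) (t : ℝ) (i : Fin 3) :
    ContDiff ℝ (⊤ : ℕ∞) (fun y => ubar Ubar y t i) := by
  have h : ContDiff ℝ (⊤ : ℕ∞) (fun y => ubar Ubar y t) :=
    (hU.comp (contDiff_const_smul _)).const_smul _
  exact (contDiff_piLp_apply 2 (i := i)).comp h

lemma contDiff_advection {Ubar : E3 → E3} (hU : ContDiff ℝ (⊤ : ℕ∞) Ubar) (t : ℝ)
    {f : E3 → ℝ} (hf : ContDiff ℝ (⊤ : ℕ∞) f) : ContDiff ℝ (⊤ : ℕ∞) (advection Ubar t f) :=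
  ContDiff.sum fun i _ => (contDiff_ubar hU t i).mul (contDiff_pd i hf)

lemma exists_bound_iteratedFDeriv_ubar {Ubar : E3 → E3} (hU : ContDiff ℝ (⊤ : ℕ∞) Ubar)
    (hUc : HasCompactSupport Ubar) (n : ℕ) (i : Fin 3) :
    ∃ M : ℝ, ∀ t : ℝ, 1 ≤ t → ∀ x,
      ‖iteratedFDeriv ℝ n (fun y => ubar Ubar y t i) x‖ ≤ M := by
  have hg : ContDiff ℝ (⊤ : ℕ∞) (fun y => Ubar y i) := (contDiff_piLp_apply 2 (i := i)).comp hU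
  have hgc : HasCompactSupport (fun y => Ubar y i) := hUc.comp_left (g := fun z : E3 => z i) rfl
  obtain ⟨M, hM⟩ := (hgc.iteratedFDeriv (𝕜 := ℝ) n).exists_bound_of_continuous
    (hg.continuous_iteratedFDeriv (by exact_mod_cast le_top))
  refine ⟨M, fun t ht x => ?_⟩
  set a : ℝ := t ^ (-(1 : ℝ) / 2) with ha
  have ha0 : 0 ≤ a := by positivity
  have ha1 : a ≤ 1 := Real.rpow_le_one_of_one_le_of_nonpos ht (by norm_num)
  have hsc : ContDiff ℝ n (fun z => Ubar (a • z) i) :=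
    (hg.comp (contDiff_const_smul a)).of_le (by exact_mod_cast le_top)
  have h1 : (fun y => ubar Ubar y t i) = a • fun z => Ubar (a • z) i := by
    funext y
    simp [ubar, ha]
  rw [h1, iteratedFDeriv_const_smul_apply hsc.contDiffAt,
    iteratedFDeriv_comp_const_smul (f := fun y => Ubar y i) a
      (hg.of_le (by exact_mod_cast le_top)), norm_smul, norm_smul, norm_pow,
    Real.norm_of_nonneg ha0, ← mul_assoc]
  calc a * a ^ n * _ ≤ 1 * M := by
        gcongr
        · exact mul_le_one₀ ha1 (by positivity) (pow_le_one₀ ha0 ha1)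
        · exact hM _
    _ = M := one_mul M

lemma exists_bound_iteratedFDeriv_advection {Ubar : E3 → E3} (hU : ContDiff ℝ (⊤ : ℕ∞) Ubar)
    (hUc : HasCompactSupport Ubar) (n : ℕ) :
    ∃ A : ℝ, 0 ≤ A ∧ ∀ t : ℝ, 1 ≤ t → ∀ f : E3 → ℝ, ContDiff ℝ (⊤ : ℕ∞) f → ∀ x,
      ‖iteratedFDeriv ℝ n (advection Ubar t f) x‖
        ≤ A * ∑ j ∈ Finset.range (n + 2), ‖iteratedFDeriv ℝ j f x‖ := by
  choose M hM using fun m i => exists_bound_iteratedFDeriv_ubar hU hUc m i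
  have hM0 (m i) : 0 ≤ M m i := (norm_nonneg _).trans (hM m i 1 le_rfl 0)
  refine ⟨∑ i, ∑ m ∈ Finset.range (n + 1), n.choose m * M m i,
    Finset.sum_nonneg fun i _ => Finset.sum_nonneg fun m _ =>
      mul_nonneg (Nat.cast_nonneg _) (hM0 m i), fun t ht f hf x => ?_⟩
  unfold advection
  rw [iteratedFDeriv_sum fun i _ =>
    ((contDiff_ubar hU t i).mul (contDiff_pd i hf)).of_le (by exact_mod_cast le_top),
    Finset.sum_apply, Finset.sum_mul]
  refine (norm_sum_le _ _).trans (Finset.sum_le_sum fun i _ => ?_)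
  refine (norm_iteratedFDeriv_mul_le (contDiff_ubar hU t i) (contDiff_pd i hf) x (n := n)
    (by exact_mod_cast le_top)).trans ?_
  rw [Finset.sum_mul]
  refine Finset.sum_le_sum fun m hm => ?_
  have h2 : ‖iteratedFDeriv ℝ (n - m) (pd f i) x‖
      ≤ ∑ j ∈ Finset.range (n + 2), ‖iteratedFDeriv ℝ j f x‖ :=
    (norm_iteratedFDeriv_pd_le _ i hf x).trans
      (Finset.single_le_sum (f := fun j => ‖iteratedFDeriv ℝ j f x‖) (fun _ _ => norm_nonneg _)
        (Finset.mem_range.2 (by omega)))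
  have := hM0 m i
  gcongr
  exact hM m i t ht x

section Spacetime

variable {V : Type*} [NormedAddCommGroup V] [NormedSpace ℝ V]

lemma uniqueDiffOn_halfSpacetime : UniqueDiffOn ℝ {q : E3 × ℝ | 1 ≤ q.2} := by
  have h : {q : E3 × ℝ | 1 ≤ q.2} = Set.univ ×ˢ Set.Ici 1 := by
    ext q
    simp
  rw [h]
  exact uniqueDiffOn_univ.prod (uniqueDiffOn_Ici 1)

lemma ContDiffOn.contDiff_slice {F : E3 × ℝ → V}
    (hF : ContDiffOn ℝ (⊤ : ℕ∞) F {q : E3 × ℝ | 1 ≤ q.2}) {t : ℝ} (ht : 1 ≤ t) :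
    ContDiff ℝ (⊤ : ℕ∞) (fun y => F (y, t)) :=
  hF.comp_contDiff (f := fun y : E3 => (y, t)) (contDiff_prodMk_left t) fun _ => ht

lemma ContDiffOn.hasFDerivAt_slice {F : E3 × ℝ → V}
    (hF : ContDiffOn ℝ (⊤ : ℕ∞) F {q : E3 × ℝ | 1 ≤ q.2}) (x : E3) {t : ℝ} (ht : 1 ≤ t) :
    HasFDerivAt (fun y => F (y, t))
      ((fderivWithin ℝ F {q : E3 × ℝ | 1 ≤ q.2} (x, t)).comp
        (ContinuousLinearMap.inl ℝ E3 ℝ)) x := by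
  have h1 := ((hF.differentiableOn (by simp)) (x, t) ht).hasFDerivWithinAt
  have h2 : HasFDerivWithinAt (fun y : E3 => (y, t)) (ContinuousLinearMap.inl ℝ E3 ℝ)
      Set.univ x := (hasFDerivAt_prodMk_left x t).hasFDerivWithinAt
  exact (h1.comp x h2 fun _ _ => ht).hasFDerivAt Filter.univ_mem

lemma ContDiffOn.spatial_fderiv {F : E3 × ℝ → V}
    (hF : ContDiffOn ℝ (⊤ : ℕ∞) F {q : E3 × ℝ | 1 ≤ q.2}) :
    ContDiffOn ℝ (⊤ : ℕ∞) (fun q : E3 × ℝ => fderiv ℝ (fun y => F (y, q.2)) q.1)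
      {q : E3 × ℝ | 1 ≤ q.2} := by
  have h : ContDiffOn ℝ (⊤ : ℕ∞) (fderivWithin ℝ F {q : E3 × ℝ | 1 ≤ q.2})
      {q : E3 × ℝ | 1 ≤ q.2} :=
    hF.fderivWithin uniqueDiffOn_halfSpacetime (by exact_mod_cast le_top)
  exact (h.clm_comp contDiffOn_const).congr fun q hq => (hF.hasFDerivAt_slice q.1 hq).fderiv

lemma ContDiffOn.spatial_iteratedFDeriv {F : E3 × ℝ → V}
    (hF : ContDiffOn ℝ (⊤ : ℕ∞) F {q : E3 × ℝ | 1 ≤ q.2}) (n : ℕ) :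
    ContDiffOn ℝ (⊤ : ℕ∞) (fun q : E3 × ℝ => iteratedFDeriv ℝ n (fun y => F (y, q.2)) q.1)
      {q : E3 × ℝ | 1 ≤ q.2} := by
  induction n with
  | zero =>
    simp_rw [iteratedFDeriv_zero_eq_comp]
    exact (continuousMultilinearCurryFin0 ℝ E3 V).symm.contDiff.comp_contDiffOn hF
  | succ n ih =>
    simp_rw [iteratedFDeriv_succ_eq_comp_left]
    exact (continuousMultilinearCurryLeftEquiv ℝ (fun _ : Fin (n + 1) => E3)
      V).symm.contDiff.comp_contDiffOn ih.spatial_fderiv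

lemma hasDerivAt_spatial_fderiv {F : E3 × ℝ → V} {G : E3 → ℝ → V}
    (hF : ContDiffOn ℝ (⊤ : ℕ∞) F {q : E3 × ℝ | 1 ≤ q.2})
    (hG : ∀ x t, 1 < t → HasDerivAt (fun s => F (x, s)) (G x t) t) (x : E3) {t : ℝ}
    (ht : 1 < t) :
    HasDerivAt (fun s => fderiv ℝ (fun y => F (y, s)) x) (fderiv ℝ (fun y => G y t) x) t := by
  have hat (y : E3) {s : ℝ} (hs : 1 < s) : ContDiffAt ℝ (⊤ : ℕ∞) F (y, s) :=
    hF.contDiffAt (by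
      refine Filter.mem_of_superset
        ((isOpen_lt continuous_const continuous_snd).mem_nhds (show (1 : ℝ) < (y, s).2 from hs))
        fun q hq => le_of_lt (show 1 < q.2 from hq))
  have hdF (y : E3) {s : ℝ} (hs : 1 < s) : HasFDerivAt F (fderiv ℝ F (y, s)) (y, s) :=
    ((hat y hs).differentiableAt (by simp)).hasFDerivAt
  have hd2 : HasFDerivAt (fderiv ℝ F) (fderiv ℝ (fderiv ℝ F) (x, t)) (x, t) :=
    (((hat x ht).fderiv_right (m := 1)
      (WithTop.coe_le_coe.2 (le_top : (1 + 1 : ℕ∞) ≤ ⊤))).differentiableAt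
      (by simp)).hasFDerivAt
  have hx (y : E3) {s : ℝ} (hs : 1 < s) :
      fderiv ℝ (fun y => F (y, s)) y = (fderiv ℝ F (y, s)).comp
        (ContinuousLinearMap.inl ℝ E3 ℝ) :=
    ((hdF y hs).comp y (hasFDerivAt_prodMk_left y s)).fderiv
  have ht' (y : E3) : G y t = fderiv ℝ F (y, t) (0, 1) := by
    refine (hG y t ht).unique ?_
    have := ((hdF y ht).comp t (hasFDerivAt_prodMk_right y t)).hasDerivAt
    simpa [Function.comp_def] using this
  have hsym := (hat x ht).isSymmSndFDerivAt minSmoothness_two_le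
  have hGx : fderiv ℝ (fun y => G y t) x
      = (fderiv ℝ (fderiv ℝ F) (x, t) (0, 1)).comp (ContinuousLinearMap.inl ℝ E3 ℝ) := by
    simp_rw [ht']
    have h3 := ((ContinuousLinearMap.apply ℝ V ((0 : E3), (1 : ℝ))).hasFDerivAt.comp x
      (hd2.comp x (hasFDerivAt_prodMk_left x t))).fderiv
    refine h3.trans ?_
    ext e
    simpa using hsym (e, 0) (0, 1)
  rw [hGx]
  have h4 : HasDerivAt (fun s => fderiv ℝ F (x, s)) (fderiv ℝ (fderiv ℝ F) (x, t) (0, 1)) t := by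
    have := (hd2.comp t (hasFDerivAt_prodMk_right x t)).hasDerivAt
    simpa [Function.comp_def] using this
  have h5 := h4.clm_comp (hasDerivAt_const t (ContinuousLinearMap.inl ℝ E3 ℝ))
  simp only [ContinuousLinearMap.comp_zero, add_zero] at h5
  refine h5.congr_of_eventuallyEq ?_
  filter_upwards [lt_mem_nhds ht] with s hs using hx x hs

lemma hasDerivAt_spatial_iteratedFDeriv {F : E3 × ℝ → V} {G : E3 → ℝ → V}
    (hF : ContDiffOn ℝ (⊤ : ℕ∞) F {q : E3 × ℝ | 1 ≤ q.2})
    (hG : ∀ x t, 1 < t → HasDerivAt (fun s => F (x, s)) (G x t) t) (n : ℕ) (x : E3) {t : ℝ}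
    (ht : 1 < t) :
    HasDerivAt (fun s => iteratedFDeriv ℝ n (fun y => F (y, s)) x)
      (iteratedFDeriv ℝ n (fun y => G y t) x) t := by
  induction n generalizing x t with
  | zero =>
    simp_rw [iteratedFDeriv_zero_eq_comp]
    exact (continuousMultilinearCurryFin0 ℝ E3 V).symm.toContinuousLinearEquiv.hasFDerivAt
      |>.comp_hasDerivAt t (hG x t ht)
  | succ n ih =>
    simp_rw [iteratedFDeriv_succ_eq_comp_left]
    exact (continuousMultilinearCurryLeftEquiv ℝ (fun _ : Fin (n + 1) => E3)
      V).symm.toContinuousLinearEquiv.hasFDerivAt.comp_hasDerivAt t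
      (hasDerivAt_spatial_fderiv (hF.spatial_iteratedFDeriv n) (fun x t ht => ih x ht) x ht)

end Spacetime

/-- The integrable weight `(1 + ‖x‖)⁻⁴` on `ℝ³`. -/
def decayWeight (x : E3) : ℝ := (1 + ‖x‖) ^ (-(4 : ℝ))

lemma decayWeight_nonneg (x : E3) : 0 ≤ decayWeight x := by
  unfold decayWeight
  positivity

lemma decayWeight_le_one (x : E3) : decayWeight x ≤ 1 :=
  Real.rpow_le_one_of_one_le_of_nonpos (by linarith [norm_nonneg x]) (by norm_num)

lemma integrable_decayWeight : Integrable decayWeight :=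
  integrable_one_add_norm (by simp; norm_num)

/-- Continuous functions on `ℝ³` dominated by a multiple of `decayWeight`. -/
def IsDecaying (g : E3 → ℝ) : Prop :=
  Continuous g ∧ ∃ C : ℝ, 0 ≤ C ∧ ∀ x, |g x| ≤ C * decayWeight x

namespace IsDecaying

variable {f g : E3 → ℝ}

lemma integrable (hf : IsDecaying f) : Integrable f := by
  obtain ⟨hc, C, -, hC⟩ := hf
  exact (integrable_decayWeight.const_mul C).mono' hc.aestronglyMeasurable (.of_forall hC)

lemma mul (hf : IsDecaying f) (hg : IsDecaying g) : IsDecaying (fun x => f x * g x) := by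
  obtain ⟨hfc, C, hC0, hC⟩ := hf
  obtain ⟨hgc, D, hD0, hD⟩ := hg
  refine ⟨hfc.mul hgc, C * D, mul_nonneg hC0 hD0, fun x => ?_⟩
  have h1 := decayWeight_nonneg x
  rw [abs_mul]
  calc |f x| * |g x| ≤ (C * decayWeight x) * (D * 1) := by
        gcongr
        · exact hC x
        · exact (hD x).trans (by gcongr; exact decayWeight_le_one x)
    _ = C * D * decayWeight x := by ring

lemma const_mul (c : ℝ) (hf : IsDecaying f) : IsDecaying (fun x => c * f x) := by
  obtain ⟨hfc, C, hC0, hC⟩ := hf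
  refine ⟨continuous_const.mul hfc, |c| * C, by positivity, fun x => ?_⟩
  rw [abs_mul, mul_assoc]
  gcongr
  exact hC x

lemma add (hf : IsDecaying f) (hg : IsDecaying g) : IsDecaying (fun x => f x + g x) := by
  obtain ⟨hfc, C, hC0, hC⟩ := hf
  obtain ⟨hgc, D, hD0, hD⟩ := hg
  refine ⟨hfc.add hgc, C + D, by positivity, fun x => ?_⟩
  rw [add_mul]
  exact (abs_add_le _ _).trans (add_le_add (hC x) (hD x))

lemma sum {ι : Type*} (s : Finset ι) {F : ι → E3 → ℝ} (hF : ∀ i ∈ s, IsDecaying (F i)) :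
    IsDecaying (fun x => ∑ i ∈ s, F i x) := by
  classical
  induction s using Finset.induction_on with
  | empty => exact ⟨by simpa using continuous_const, 0, le_rfl, by simp⟩
  | insert a s ha ih =>
    simp_rw [Finset.sum_insert ha]
    exact (hF a (Finset.mem_insert_self a s)).add
      (ih fun i hi => hF i (Finset.mem_insert_of_mem hi))

lemma of_abs_le (hf : Continuous f) (hg : IsDecaying g) (h : ∀ x, |f x| ≤ g x) :
    IsDecaying f := by
  obtain ⟨-, C, hC0, hC⟩ := hg
  exact ⟨hf, C, hC0, fun x => (h x).trans ((le_abs_self _).trans (hC x))⟩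

end IsDecaying

lemma neg_two_mul_mul_le_of_abs_le_sum (n : ℕ) (p : ℕ → ℝ) (hp : ∀ j, 0 ≤ p j)
    {A ε w h : ℝ} (hA : 0 ≤ A) (hε : 0 < ε) (hw : |w| ≤ p n)
    (hh : |h| ≤ A * ∑ j ∈ Finset.range (n + 2), p j) :
    -(2 * (w * h)) ≤ ε * p (n + 1) ^ 2
      + (A ^ 2 / ε + 2 * A * (n + 1)) * ∑ j ∈ Finset.range (n + 1), p j ^ 2 := by
  have h1 : -(w * h) ≤ p n * (A * ∑ j ∈ Finset.range (n + 2), p j) :=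
    (neg_le_abs _).trans (by
      rw [abs_mul]
      exact mul_le_mul hw hh (abs_nonneg _) (hp n))
  have h2 : p n ≤ ∑ j ∈ Finset.range (n + 1), p j :=
    Finset.single_le_sum (fun j _ => hp j) (Finset.self_mem_range_succ n)
  have h3 : p n ^ 2 ≤ ∑ j ∈ Finset.range (n + 1), p j ^ 2 :=
    Finset.single_le_sum (f := fun j => p j ^ 2) (fun j _ => sq_nonneg _)
      (Finset.self_mem_range_succ n)
  have h4 : (∑ j ∈ Finset.range (n + 1), p j) ^ 2
      ≤ (n + 1) * ∑ j ∈ Finset.range (n + 1), p j ^ 2 := by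
    simpa using sq_sum_le_card_mul_sum_sq (s := Finset.range (n + 1)) (f := p)
  rw [Finset.sum_range_succ] at h1
  set s₁ := ∑ j ∈ Finset.range (n + 1), p j
  set s₂ := ∑ j ∈ Finset.range (n + 1), p j ^ 2
  have h5 : 2 * (A * p n * p (n + 1)) ≤ ε * p (n + 1) ^ 2 + A ^ 2 / ε * p n ^ 2 := by
    have : 0 ≤ (ε * p (n + 1) - A * p n) ^ 2 / ε := by positivity
    have e : (ε * p (n + 1) - A * p n) ^ 2 / ε
        = ε * p (n + 1) ^ 2 - 2 * (A * p n * p (n + 1)) + A ^ 2 / ε * p n ^ 2 := by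
      field_simp
      ring
    linarith
  have h6 : A ^ 2 / ε * p n ^ 2 ≤ A ^ 2 / ε * s₂ := by gcongr
  have h7 : A * (p n * s₁) ≤ A * ((n + 1) * s₂) := by
    refine mul_le_mul_of_nonneg_left (le_trans ?_ h4) hA
    rw [sq]
    exact mul_le_mul_of_nonneg_right h2 ((hp n).trans h2)
  linarith

lemma sum_mixedPD_cons (n : ℕ) (g : (Fin (n + 1) → Fin 3) → ℝ) :
    ∑ v : Fin n → Fin 3, ∑ i, g (Fin.cons i v) = ∑ v, g v := by
  rw [← (Fin.consEquiv fun _ : Fin (n + 1) => Fin 3).sum_comp, Fintype.sum_prod_type_right]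
  rfl

section FixedTime

variable {f : E3 → ℝ}

lemma isDecaying_mixedPD (hf : ContDiff ℝ (⊤ : ℕ∞) f)
    (hdec : ∀ n, IsDecaying fun x => ‖iteratedFDeriv ℝ n f x‖) {n : ℕ} (v : Fin n → Fin 3) :
    IsDecaying (mixedPD v f) :=
  .of_abs_le (contDiff_mixedPD v hf).continuous (hdec n) (abs_mixedPD_le v f)

lemma integral_mixedPD_mul_pd_pd (hf : ContDiff ℝ (⊤ : ℕ∞) f)
    (hdec : ∀ n, IsDecaying fun x => ‖iteratedFDeriv ℝ n f x‖) {n : ℕ} (v : Fin n → Fin 3)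
    (i : Fin 3) :
    IsDecaying (fun x => mixedPD v f x * pd (pd (mixedPD v f) i) i x) ∧
    ∫ x, mixedPD v f x * pd (pd (mixedPD v f) i) i x
      = -∫ x, mixedPD (Fin.cons i v : Fin (n + 1) → Fin 3) f x ^ 2 := by
  have h0 := isDecaying_mixedPD hf hdec v
  have e1 : pd (mixedPD v f) i = mixedPD (Fin.cons i v : Fin (n + 1) → Fin 3) f :=
    funext (pd_mixedPD v i hf)
  have h1 := isDecaying_mixedPD hf hdec (Fin.cons i v : Fin (n + 1) → Fin 3)
  have e2 : pd (pd (mixedPD v f) i) i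
      = mixedPD (Fin.cons i (Fin.cons i v : Fin (n + 1) → Fin 3) : Fin (n + 2) → Fin 3) f := by
    rw [e1]
    exact funext (pd_mixedPD _ i hf)
  have h2 := isDecaying_mixedPD hf hdec
    (Fin.cons i (Fin.cons i v : Fin (n + 1) → Fin 3) : Fin (n + 2) → Fin 3)
  have hd := (contDiff_mixedPD v hf).differentiable (by simp)
  have hd' := (contDiff_mixedPD (Fin.cons i v : Fin (n + 1) → Fin 3) hf).differentiable (by simp)
  have hw : (fun x => fderiv ℝ (mixedPD v f) x (EuclideanSpace.single i 1))
      = mixedPD (Fin.cons i v : Fin (n + 1) → Fin 3) f := e1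
  have hw' : (fun x => fderiv ℝ (mixedPD (Fin.cons i v : Fin (n + 1) → Fin 3) f) x
      (EuclideanSpace.single i 1)) = mixedPD (Fin.cons i (Fin.cons i v : Fin (n + 1) → Fin 3) :
        Fin (n + 2) → Fin 3) f := by
    rw [← e2, e1]
    rfl
  refine ⟨by rw [e2]; exact h0.mul h2, ?_⟩
  have := integral_mul_fderiv_eq_neg_fderiv_mul_of_integrable (μ := volume) (𝕜 := ℝ)
    (f := mixedPD v f) (g := mixedPD (Fin.cons i v : Fin (n + 1) → Fin 3) f)
    (v := EuclideanSpace.single i 1)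
    (by simp only [congrFun hw]; exact (h1.mul h1).integrable)
    (by simp only [congrFun hw']; exact (h0.mul h2).integrable)
    (h0.mul h1).integrable (fun x _ => hd x) (fun x _ => hd' x)
  simp only [congrFun hw, congrFun hw'] at this
  rw [e2, this]
  simp_rw [sq]

lemma isDecaying_mixedPD_advection {Ubar : E3 → E3} (hU : ContDiff ℝ (⊤ : ℕ∞) Ubar)
    (hUc : HasCompactSupport Ubar) (hf : ContDiff ℝ (⊤ : ℕ∞) f)
    (hdec : ∀ n, IsDecaying fun x => ‖iteratedFDeriv ℝ n f x‖) {n : ℕ} (v : Fin n → Fin 3)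
    {t : ℝ} (ht : 1 ≤ t) : IsDecaying (mixedPD v (advection Ubar t f)) := by
  obtain ⟨A, -, hA⟩ := exists_bound_iteratedFDeriv_advection hU hUc n
  exact .of_abs_le (contDiff_mixedPD v (contDiff_advection hU t hf)).continuous
    ((IsDecaying.sum (Finset.range (n + 2)) fun j _ => hdec j).const_mul A)
    fun x => (abs_mixedPD_le v _ x).trans (hA t ht f hf x)

lemma exists_energy_production_le {Ubar : E3 → E3} (hU : ContDiff ℝ (⊤ : ℕ∞) Ubar)
    (hUc : HasCompactSupport Ubar) (n : ℕ) :
    ∃ K : ℝ, 0 ≤ K ∧ ∀ t : ℝ, 1 ≤ t → ∀ f : E3 → ℝ, ContDiff ℝ (⊤ : ℕ∞) f →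
      (∀ n, IsDecaying fun x => ‖iteratedFDeriv ℝ n f x‖) →
      ∑ v : Fin n → Fin 3, ∫ x, 2 * (mixedPD v f x *
          (mixedPD v (lap f) x - mixedPD v (advection Ubar t f) x))
        ≤ K * sobSq n f - (1 / 3 ^ (n + 1)) * ∫ x, ‖iteratedFDeriv ℝ (n + 1) f x‖ ^ 2 := by
  obtain ⟨A, hA0, hA⟩ := exists_bound_iteratedFDeriv_advection hU hUc n
  set ε : ℝ := 1 / 3 ^ (n + 1) / 3 ^ n with hε
  have hε0 : 0 < ε := by positivity
  set K : ℝ := A ^ 2 / ε + 2 * A * (n + 1) with hK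
  have hK0 : 0 ≤ K := by positivity
  refine ⟨3 ^ n * K, by positivity, fun t ht f hf hdec => ?_⟩
  have hsq (m : ℕ) : IsDecaying fun x => ‖iteratedFDeriv ℝ m f x‖ ^ 2 := by
    simp_rw [sq]
    exact (hdec m).mul (hdec m)
  have hD {m : ℕ} (v : Fin m → Fin 3) : IsDecaying (mixedPD v f) :=
    isDecaying_mixedPD hf hdec v
  have hD2 {m : ℕ} (v : Fin m → Fin 3) : IsDecaying fun x => mixedPD v f x ^ 2 := by
    simp_rw [sq]
    exact (hD v).mul (hD v)
  set Q := ∫ x, ‖iteratedFDeriv ℝ (n + 1) f x‖ ^ 2 with hQ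
  have hQle : Q ≤ 3 ^ (n + 1) * ∑ v : Fin (n + 1) → Fin 3, ∫ x, mixedPD v f x ^ 2 := by
    rw [← integral_finsetSum _ fun v _ => (hD2 v).integrable, ← integral_const_mul]
    exact integral_mono (hsq _).integrable
      ((IsDecaying.sum _ fun v _ => hD2 v).const_mul _).integrable
      fun x => sq_norm_iteratedFDeriv_le (n + 1) f x
  have hv (v : Fin n → Fin 3) : ∫ x, 2 * (mixedPD v f x *
      (mixedPD v (lap f) x - mixedPD v (advection Ubar t f) x))
      ≤ -2 * (∑ i, ∫ x, mixedPD (Fin.cons i v : Fin (n + 1) → Fin 3) f x ^ 2)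
        + (ε * Q + K * sobSq n f) := by
    have hadv := (hD v).mul (isDecaying_mixedPD_advection hU hUc hf hdec v ht)
    have hpp (i : Fin 3) := integral_mixedPD_mul_pd_pd hf hdec v i
    have e : (fun x => 2 * (mixedPD v f x *
        (mixedPD v (lap f) x - mixedPD v (advection Ubar t f) x)))
        = fun x => 2 * (∑ i, mixedPD v f x * pd (pd (mixedPD v f) i) i x)
          + (-2) * (mixedPD v f x * mixedPD v (advection Ubar t f) x) := by
      funext x
      rw [mixedPD_lap v hf, ← Finset.mul_sum]
      ring
    rw [e, integral_add ((IsDecaying.sum _ fun i _ => (hpp i).1).const_mul 2).integrable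
      (hadv.const_mul _).integrable, integral_const_mul,
      integral_finsetSum _ fun i _ => (hpp i).1.integrable]
    simp_rw [(hpp _).2]
    rw [Finset.sum_neg_distrib]
    have hlow : ∫ x, (-2) * (mixedPD v f x * mixedPD v (advection Ubar t f) x)
        ≤ ε * Q + K * sobSq n f := by
      have hs := IsDecaying.sum (Finset.range (n + 1)) fun j _ => hsq j
      unfold sobSq
      rw [hQ, ← integral_finsetSum _ fun j _ => (hsq j).integrable, ← integral_const_mul,
        ← integral_const_mul, ← integral_add ((hsq _).const_mul _).integrable
          (hs.const_mul _).integrable]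
      refine integral_mono (hadv.const_mul _).integrable
        (((hsq _).const_mul _).add (hs.const_mul _)).integrable fun x => ?_
      have := neg_two_mul_mul_le_of_abs_le_sum n (fun j => ‖iteratedFDeriv ℝ j f x‖)
        (fun j => norm_nonneg _) hA0 hε0 (abs_mixedPD_le v f x)
        ((abs_mixedPD_le v _ x).trans (hA t ht f hf x))
      simp only at this ⊢
      linarith
    linarith
  refine (Finset.sum_le_sum fun v _ => hv v).trans ?_
  rw [Finset.sum_add_distrib, ← Finset.mul_sum,
    sum_mixedPD_cons n fun v => ∫ x, mixedPD v f x ^ 2]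
  set P := ∑ v : Fin (n + 1) → Fin 3, ∫ x, mixedPD v f x ^ 2
  have h3 : (1 / 3 ^ (n + 1) : ℝ) * Q ≤ P := by
    rw [one_div, inv_mul_le_iff₀ (by positivity)]
    exact hQle
  have h4 : (3 : ℝ) ^ n * (ε * Q) = (1 / 3 ^ (n + 1) : ℝ) * Q := by
    rw [hε]
    field_simp
  simp only [Finset.sum_const, Finset.card_univ, Fintype.card_fun, Fintype.card_fin,
    nsmul_eq_mul]
  push_cast
  linarith

end FixedTime

namespace IsAdmissible

variable {Ubar : E3 → E3} {θ : E3 → ℝ → ℝ}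

lemma contDiff (h : IsAdmissible Ubar θ) {t : ℝ} (ht : 1 ≤ t) :
    ContDiff ℝ (⊤ : ℕ∞) (fun y => θ y t) :=
  h.1.contDiff_slice ht

lemma exists_le_decayWeight (h : IsAdmissible Ubar θ) (n : ℕ) (T : ℝ) :
    ∃ C : ℝ, 0 ≤ C ∧ ∀ x t, 1 ≤ t → t ≤ T →
      ‖iteratedFDeriv ℝ n (fun y => θ y t) x‖ ≤ C * decayWeight x := by
  obtain ⟨C₀, h₀⟩ := h.2.2 0 n T
  obtain ⟨C₄, h₄⟩ := h.2.2 4 n T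
  refine ⟨max (8 * (C₀ + C₄)) 0, le_max_right _ _, fun x t ht htT => ?_⟩
  have a₀ := h₀ x t ht htT
  have a₄ := h₄ x t ht htT
  set N := ‖iteratedFDeriv ℝ n (fun y => θ y t) x‖
  have hN : 0 ≤ N := norm_nonneg _
  have hx : 0 ≤ ‖x‖ := norm_nonneg _
  have e : decayWeight x = ((1 + ‖x‖) ^ 4)⁻¹ := by
    unfold decayWeight
    rw [Real.rpow_neg (by positivity)]
    norm_cast
  rw [e, ← div_eq_mul_inv, le_div_iff₀ (by positivity)]
  refine le_trans ?_ (le_max_left _ _)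
  have h8 : (1 + ‖x‖) ^ 4 ≤ 8 * (1 + ‖x‖ ^ 4) := by
    have := add_pow_le zero_le_one hx 4
    norm_num at this
    linarith
  calc N * (1 + ‖x‖) ^ 4 ≤ N * (8 * (1 + ‖x‖ ^ 4)) := by gcongr
    _ = 8 * (‖x‖ ^ 0 * N + ‖x‖ ^ 4 * N) := by ring
    _ ≤ _ := by gcongr

lemma isDecaying (h : IsAdmissible Ubar θ) {t : ℝ} (ht : 1 ≤ t) (n : ℕ) :
    IsDecaying fun x => ‖iteratedFDeriv ℝ n (fun y => θ y t) x‖ := by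
  obtain ⟨C, hC0, hC⟩ := h.exists_le_decayWeight n t
  refine ⟨((h.contDiff ht).continuous_iteratedFDeriv (by exact_mod_cast le_top)).norm, C, hC0,
    fun x => ?_⟩
  rw [abs_norm]
  exact hC x t ht le_rfl

lemma continuousOn_iteratedFDeriv (h : IsAdmissible Ubar θ) (n : ℕ) (x : E3) :
    ContinuousOn (fun s => iteratedFDeriv ℝ n (fun y => θ y s) x) (Set.Ici 1) :=
  (h.1.spatial_iteratedFDeriv n).continuousOn.comp (f := fun s : ℝ => (x, s))
    (by fun_prop) fun _ hs => hs

lemma continuousOn_integral (h : IsAdmissible Ubar θ) (n : ℕ) (T : ℝ) {g : ℝ → E3 → ℝ}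
    (hg : ∀ s, 1 ≤ s → Continuous (g s))
    (hgs : ∀ x, ContinuousOn (fun s => g s x) (Set.Ici 1))
    (hle : ∀ s, 1 ≤ s → ∀ x, |g s x| ≤ ‖iteratedFDeriv ℝ n (fun y => θ y s) x‖ ^ 2) :
    ContinuousOn (fun s => ∫ x, g s x) (Set.Icc 1 T) := by
  obtain ⟨C, hC0, hC⟩ := h.exists_le_decayWeight n T
  refine continuousOn_of_dominated (bound := fun x => C ^ 2 * decayWeight x)
    (fun s hs => (hg s hs.1).aestronglyMeasurable) (fun s hs => .of_forall fun x => ?_)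
    (integrable_decayWeight.const_mul _)
    (.of_forall fun x => (hgs x).mono Set.Icc_subset_Ici_self)
  have h0 := decayWeight_nonneg x
  calc |g s x| ≤ ‖iteratedFDeriv ℝ n (fun y => θ y s) x‖ ^ 2 := hle s hs.1 x
    _ ≤ (C * decayWeight x) ^ 2 := by
        gcongr
        exact hC x s hs.1 hs.2
    _ = C ^ 2 * (decayWeight x * decayWeight x) := by ring
    _ ≤ C ^ 2 * (decayWeight x * 1) := by
        gcongr
        exact decayWeight_le_one x
    _ = _ := by ring

lemma continuousOn_integral_sq_norm (h : IsAdmissible Ubar θ) (n : ℕ) (T : ℝ) :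
    ContinuousOn (fun s => ∫ x, ‖iteratedFDeriv ℝ n (fun y => θ y s) x‖ ^ 2) (Set.Icc 1 T) :=
  h.continuousOn_integral n T
    (fun s hs => (h.isDecaying hs n).1.pow 2)
    (fun x => (h.continuousOn_iteratedFDeriv n x).norm.pow 2)
    fun s _ x => by rw [abs_of_nonneg (by positivity)]

lemma continuousOn_integral_sq_mixedPD (h : IsAdmissible Ubar θ) {n : ℕ} (v : Fin n → Fin 3)
    (T : ℝ) :
    ContinuousOn (fun s => ∫ x, mixedPD v (fun y => θ y s) x ^ 2) (Set.Icc 1 T) :=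
  h.continuousOn_integral n T
    (fun s hs => (contDiff_mixedPD v (h.contDiff hs)).continuous.pow 2)
    (fun x => ((ContinuousMultilinearMap.apply ℝ (fun _ : Fin n => E3) ℝ
      (fun j => EuclideanSpace.single (v j) (1 : ℝ))).continuous.comp_continuousOn
        (h.continuousOn_iteratedFDeriv n x)).pow 2)
    fun s _ x => by
      rw [abs_of_nonneg (by positivity), ← sq_abs]
      gcongr
      exact abs_mixedPD_le v _ x

lemma hasDerivAt_mixedPD (hU : ContDiff ℝ (⊤ : ℕ∞) Ubar) (h : IsAdmissible Ubar θ) {n : ℕ}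
    (v : Fin n → Fin 3) (x : E3) {t : ℝ} (ht : 1 < t) :
    HasDerivAt (fun s => mixedPD v (fun y => θ y s) x)
      (mixedPD v (lap fun y => θ y t) x
        - mixedPD v (advection Ubar t fun y => θ y t) x) t := by
  have hG : ∀ x t, 1 < t → HasDerivAt (fun s => θ x s)
      (lap (fun y => θ y t) x - advection Ubar t (fun y => θ y t) x) t := by
    intro x t ht
    have hat : ContDiffAt ℝ (⊤ : ℕ∞) (fun q : E3 × ℝ => θ q.1 q.2) (x, t) :=
      h.1.contDiffAt (Filter.mem_of_superset
        ((isOpen_lt continuous_const continuous_snd).mem_nhds (show (1 : ℝ) < (x, t).2 from ht))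
        fun q hq => le_of_lt (show 1 < q.2 from hq))
    have hd : DifferentiableAt ℝ (fun s => θ x s) t :=
      ((hat.differentiableAt (by simp)).hasFDerivAt.comp t
        (hasFDerivAt_prodMk_right x t)).differentiableAt
    have := hd.hasDerivAt
    rwa [h.2.1 x t ht.le] at this
  rw [← mixedPD_sub v (contDiff_lap (h.contDiff ht.le))
    (contDiff_advection hU t (h.contDiff ht.le))]
  exact (ContinuousMultilinearMap.apply ℝ (fun _ : Fin n => E3) ℝ
    (fun j => EuclideanSpace.single (v j) (1 : ℝ))).hasFDerivAt.comp_hasDerivAt t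
    (hasDerivAt_spatial_iteratedFDeriv h.1 hG n x ht)

lemma exists_bound_time_derivative (hU : ContDiff ℝ (⊤ : ℕ∞) Ubar)
    (hUc : HasCompactSupport Ubar) (h : IsAdmissible Ubar θ) {n : ℕ} (v : Fin n → Fin 3)
    (T : ℝ) :
    ∃ B : ℝ, ∀ x t, 1 ≤ t → t ≤ T → |mixedPD v (lap fun y => θ y t) x
        - mixedPD v (advection Ubar t fun y => θ y t) x| ≤ B := by
  choose C hC0 hC using fun n => h.exists_le_decayWeight n T
  have hle (m : ℕ) (x : E3) (t : ℝ) (ht : 1 ≤ t) (htT : t ≤ T) :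
      ‖iteratedFDeriv ℝ m (fun y => θ y t) x‖ ≤ C m :=
    (hC m x t ht htT).trans (mul_le_of_le_one_right (hC0 m) (decayWeight_le_one x))
  obtain ⟨A, hA0, hA⟩ := exists_bound_iteratedFDeriv_advection hU hUc n
  refine ⟨∑ _i : Fin 3, C (n + 2) + A * ∑ j ∈ Finset.range (n + 2), C j, fun x t ht htT => ?_⟩
  have hf := h.contDiff ht
  refine (abs_sub _ _).trans (add_le_add ?_ ?_)
  · unfold lap
    rw [mixedPD_sum _ _ fun i _ => contDiff_pd i (contDiff_pd i hf)]
    refine (Finset.abs_sum_le_sum_abs _ _).trans (Finset.sum_le_sum fun i _ => ?_)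
    exact (abs_mixedPD_le v _ x).trans
      ((norm_iteratedFDeriv_pd_le n i (contDiff_pd i hf) x).trans
        ((norm_iteratedFDeriv_pd_le (n + 1) i hf x).trans (hle _ x t ht htT)))
  · refine (abs_mixedPD_le v _ x).trans ((hA t ht _ hf x).trans ?_)
    gcongr with j _
    exact hle j x t ht htT

lemma hasDerivAt_integral_sq_mixedPD (hU : ContDiff ℝ (⊤ : ℕ∞) Ubar)
    (hUc : HasCompactSupport Ubar) (h : IsAdmissible Ubar θ) {n : ℕ} (v : Fin n → Fin 3)
    {t : ℝ} (ht : 1 < t) :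
    HasDerivAt (fun s => ∫ x, mixedPD v (fun y => θ y s) x ^ 2)
      (∫ x, 2 * (mixedPD v (fun y => θ y t) x * (mixedPD v (lap fun y => θ y t) x
        - mixedPD v (advection Ubar t fun y => θ y t) x))) t := by
  obtain ⟨C, hC0, hC⟩ := h.exists_le_decayWeight n (t + 1)
  obtain ⟨B, hB⟩ := h.exists_bound_time_derivative hU hUc v (t + 1)
  have hf := h.contDiff ht.le
  refine (hasDerivAt_integral_of_dominated_loc_of_deriv_le
    (F := fun s x => mixedPD v (fun y => θ y s) x ^ 2)
    (F' := fun s x => 2 * (mixedPD v (fun y => θ y s) x * (mixedPD v (lap fun y => θ y s) x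
        - mixedPD v (advection Ubar s fun y => θ y s) x)))
    (bound := fun x => 2 * (C * B) * decayWeight x)
    (Ioo_mem_nhds ht (lt_add_one t)) ?_ ?_ ?_ ?_ (integrable_decayWeight.const_mul _) ?_).2
  · filter_upwards [lt_mem_nhds ht] with s hs
    exact ((contDiff_mixedPD v (h.contDiff hs.le)).continuous.pow 2).aestronglyMeasurable
  · have := isDecaying_mixedPD hf (h.isDecaying ht.le) v
    simp_rw [sq]
    exact (this.mul this).integrable
  · exact (continuous_const.mul ((contDiff_mixedPD v hf).continuous.mul
      ((contDiff_mixedPD v (contDiff_lap hf)).continuous.sub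
        (contDiff_mixedPD v (contDiff_advection hU t hf)).continuous))).aestronglyMeasurable
  · refine .of_forall fun x s hs => ?_
    have h1 := (abs_mixedPD_le v _ x).trans (hC x s hs.1.le hs.2.le)
    have h2 := hB x s hs.1.le hs.2.le
    have h3 := mul_nonneg hC0 (decayWeight_nonneg x)
    rw [Real.norm_eq_abs, abs_mul, abs_mul, abs_two]
    calc _ ≤ 2 * ((C * decayWeight x) * B) := by gcongr
      _ = _ := by ring
  · refine .of_forall fun x s hs => ?_
    refine ((hasDerivAt_mixedPD hU h v x hs.1).pow 2).congr_deriv ?_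
    push_cast
    ring

end IsAdmissible

/-- **Energy inequality at derivative level `k` for the advected heat equation.**  For every
integer `k ≥ 1` there is `C = C(k, Ū)` such that any admissible solution of
`∂ₜθ = Δθ − ū·∇θ` on `[1,∞)` satisfies, for all `t > 1`,
`‖∇^{k−1}θ(t)‖² + ∫₁ᵗ ‖∇^kθ(s)‖² ds ≤ C (‖∇^{k−1}θ(1)‖² + ∫₁ᵗ ‖θ(s)‖²_{H^{k−1}} ds)`. -/
theorem advected_heat_level_k_energy
    (Ubar : E3 → E3) (hU : ContDiff ℝ (⊤ : ℕ∞) Ubar) (hUc : HasCompactSupport Ubar)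
    (hUdiv : ∀ x, divg Ubar x = 0) :
    ∀ k : ℕ, 1 ≤ k → ∃ C : ℝ,
      ∀ θ : E3 → ℝ → ℝ, IsAdmissible Ubar θ →
        ∀ t : ℝ, 1 < t →
          (∫ x : E3, ‖iteratedFDeriv ℝ (k - 1) (fun y => θ y t) x‖ ^ 2)
              + (∫ s in (1:ℝ)..t, ∫ x : E3, ‖iteratedFDeriv ℝ k (fun y => θ y s) x‖ ^ 2)
            ≤ C * ((∫ x : E3, ‖iteratedFDeriv ℝ (k - 1) (fun y => θ y 1) x‖ ^ 2)
              + ∫ s in (1:ℝ)..t, sobSq (k - 1) (fun x => θ x s)) := by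
  intro k hk
  obtain ⟨n, rfl⟩ : ∃ n, k = n + 1 := ⟨k - 1, by omega⟩
  simp only [Nat.add_sub_cancel]
  obtain ⟨K, hK0, hK⟩ := exists_energy_production_le hU hUc n
  refine ⟨(3 ^ n + 3 ^ (n + 1)) * (3 ^ n + K), fun θ hθ t ht => ?_⟩
  set E : ℝ → ℝ := fun s => ∑ v : Fin n → Fin 3, ∫ x, mixedPD v (fun y => θ y s) x ^ 2 with hE
  set P : ℝ → ℝ := fun s => ∫ x, ‖iteratedFDeriv ℝ n (fun y => θ y s) x‖ ^ 2 with hP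
  set Q : ℝ → ℝ := fun s => ∫ x, ‖iteratedFDeriv ℝ (n + 1) (fun y => θ y s) x‖ ^ 2 with hQ
  set S : ℝ → ℝ := fun s => sobSq n (fun x => θ x s) with hS
  have hQc : ContinuousOn Q (Set.Icc 1 t) := hθ.continuousOn_integral_sq_norm (n + 1) t
  have hSc : ContinuousOn S (Set.Icc 1 t) :=
    continuousOn_finsetSum _ fun j _ => hθ.continuousOn_integral_sq_norm j t
  have hEc : ContinuousOn E (Set.Icc 1 t) :=
    continuousOn_finsetSum _ fun v _ => hθ.continuousOn_integral_sq_mixedPD v t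
  have hEd (s : ℝ) (hs : s ∈ Set.Ioo 1 t) :=
    HasDerivAt.fun_sum fun v (_ : v ∈ (Finset.univ : Finset (Fin n → Fin 3))) =>
      hθ.hasDerivAt_integral_sq_mixedPD hU hUc v hs.1
  have hφ : ContinuousOn (fun s => K * S s - (1 / 3 ^ (n + 1)) * Q s) (Set.Icc 1 t) :=
    (continuousOn_const.mul hSc).sub (continuousOn_const.mul hQc)
  have key := intervalIntegral.sub_le_integral_of_hasDeriv_right_of_le ht.le hEc
    (fun s hs => (hEd s hs).hasDerivWithinAt) hφ.integrableOn_Icc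
    (fun s hs => hK s hs.1.le _ (hθ.contDiff hs.1.le) (hθ.isDecaying hs.1.le))
  have hSi : IntervalIntegrable S volume 1 t := hSc.intervalIntegrable_of_Icc ht.le
  have hQi : IntervalIntegrable Q volume 1 t := hQc.intervalIntegrable_of_Icc ht.le
  rw [intervalIntegral.integral_sub (hSi.const_mul _) (hQi.const_mul _),
    intervalIntegral.integral_const_mul, intervalIntegral.integral_const_mul] at key
  have hint {s : ℝ} (hs : 1 ≤ s) (v : Fin n → Fin 3) :
      IsDecaying fun x => mixedPD v (fun y => θ y s) x ^ 2 := by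
    have := isDecaying_mixedPD (hθ.contDiff hs) (hθ.isDecaying hs) v
    simp_rw [sq]
    exact this.mul this
  have hsq {s : ℝ} (hs : 1 ≤ s) :
      IsDecaying fun x => ‖iteratedFDeriv ℝ n (fun y => θ y s) x‖ ^ 2 := by
    simp_rw [sq]
    exact (hθ.isDecaying hs n).mul (hθ.isDecaying hs n)
  have hPE : P t ≤ 3 ^ n * E t := by
    simp only [hP, hE]
    rw [← integral_finsetSum _ fun v _ => (hint ht.le v).integrable, ← integral_const_mul]
    exact integral_mono (hsq ht.le).integrable
      ((IsDecaying.sum _ fun v _ => hint ht.le v).const_mul _).integrable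
      fun x => sq_norm_iteratedFDeriv_le n _ x
  have hEP : E 1 ≤ 3 ^ n * P 1 := by
    simp only [hP, hE]
    rw [← integral_finsetSum _ fun v _ => (hint le_rfl v).integrable, ← integral_const_mul]
    exact integral_mono (IsDecaying.sum _ fun v _ => hint le_rfl v).integrable
      ((hsq le_rfl).const_mul _).integrable fun x => sum_sq_mixedPD_le n _ x
  have hE0 : 0 ≤ E t := Finset.sum_nonneg fun v _ => integral_nonneg fun x => sq_nonneg _
  have hP0 : 0 ≤ P 1 := integral_nonneg fun x => sq_nonneg _
  have hI0 : 0 ≤ ∫ s in (1 : ℝ)..t, Q s :=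
    intervalIntegral.integral_nonneg ht.le fun s _ => integral_nonneg fun x => sq_nonneg _
  have hJ0 : 0 ≤ ∫ s in (1 : ℝ)..t, S s :=
    intervalIntegral.integral_nonneg ht.le fun s _ =>
      Finset.sum_nonneg fun j _ => integral_nonneg fun x => sq_nonneg _
  change P t + (∫ s in (1 : ℝ)..t, Q s) ≤ _ * (P 1 + ∫ s in (1 : ℝ)..t, S s)
  set I := ∫ s in (1 : ℝ)..t, Q s
  set J := ∫ s in (1 : ℝ)..t, S s
  set R : ℝ := 3 ^ n * P 1 + K * J with hR
  have hER : E t + 1 / 3 ^ (n + 1) * I ≤ R := by linarith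
  have hI0' : 0 ≤ 1 / 3 ^ (n + 1) * I := by positivity
  have h1 : P t ≤ 3 ^ n * R := hPE.trans (by gcongr; linarith)
  have h2 : I ≤ 3 ^ (n + 1) * R := by
    have : 1 / 3 ^ (n + 1) * I ≤ R := by linarith
    rwa [one_div, inv_mul_le_iff₀ (by positivity)] at this
  have h3 : R ≤ (3 ^ n + K) * (P 1 + J) := by
    have h4 : 0 ≤ (3 : ℝ) ^ n * J := by positivity
    have h5 : 0 ≤ K * P 1 := by positivity
    linarith
  calc P t + I ≤ (3 ^ n + 3 ^ (n + 1)) * R := by linarith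
    _ ≤ (3 ^ n + 3 ^ (n + 1)) * ((3 ^ n + K) * (P 1 + J)) := by gcongr
    _ = _ := by ring
end
end

section
/- Let Ū ∈ C_c^∞(ℝ³;ℝ³) be divergence-free and let Θ be an admissible solution on [0,∞) of ∂_τΘ = ΔΘ + ½Θ + ½ξ·∇Θ − Ū·∇Θ. Then for all integers k ≥ m ≥ 0 there exists a constant C = C(k, m, Ū) such that for all τ > 0: ‖Θ(·,τ)‖_{H^k} ≤ C·max{τ^{−(k−m)/2}, 1}·‖Θ(·,0)‖_{H^m}. -/
noncomputable section

open MeasureTheory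
open scoped ENNReal BigOperators

/-- The drift–diffusion operator in self-similar variables,
`L Θ = ΔΘ + ½Θ + ½ ξ·∇Θ − Ū·∇Θ`, evaluated at `ξ` on the time slice `Θ`. -/
noncomputable def Lgen (Ubar : E3 → E3) (Θ : E3 → ℝ) (ξ : E3) : ℝ :=
  lap Θ ξ + (1 / 2) * Θ ξ + (1 / 2) * (∑ i, ξ i * pd Θ i ξ)
    - ∑ i, Ubar ξ i * pd Θ i ξ

/-- `Θ` is an admissible solution, on the time interval `I`, of the drift–diffusion
equation `∂_τΘ = ΔΘ + ½Θ + ½ξ·∇Θ − Ū·∇Θ`: it is smooth, solves the equation pointwise,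
and together with all its spatial derivatives decays in `ξ` faster than any polynomial,
locally uniformly in `τ`. -/
def IsAdmissibleSS (Ubar : E3 → E3) (I : Set ℝ) (Θ : E3 → ℝ → ℝ) : Prop :=
  ContDiffOn ℝ (⊤ : ℕ∞) (fun q : E3 × ℝ => Θ q.1 q.2) {q : E3 × ℝ | q.2 ∈ I} ∧
  (∀ (ξ : E3) (τ : ℝ), τ ∈ I →
    deriv (fun s => Θ ξ s) τ = Lgen Ubar (fun y => Θ y τ) ξ) ∧
  (∀ (n k : ℕ) (a b : ℝ), ∃ C : ℝ, ∀ (ξ : E3) (τ : ℝ), τ ∈ I → a ≤ τ → τ ≤ b →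
    ‖ξ‖ ^ n * ‖iteratedFDeriv ℝ k (fun y => Θ y τ) ξ‖ ≤ C)

open scoped SchwartzMap LineDeriv

/-- Scalar Schwartz functions on `ℝ³`. -/
abbrev Sch : Type := 𝓢(E3, ℝ)

/-- The `i`-th partial derivative on Schwartz space. -/
def schD (i : Fin 3) : Sch →L[ℝ] Sch :=
  LineDeriv.lineDerivOpCLM ℝ Sch (EuclideanSpace.single i (1 : ℝ) : E3)

/-- Multiplication by a function of temperate growth. -/
abbrev schMul (a : E3 → ℝ) : Sch →L[ℝ] Sch := SchwartzMap.smulLeftCLM ℝ a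

lemma schD_apply (i : Fin 3) (f : Sch) (x : E3) : schD i f x = pd f i x := rfl

lemma schMul_apply {a : E3 → ℝ} (ha : a.HasTemperateGrowth) (f : Sch) (x : E3) :
    schMul a f x = a x * f x := by
  simp [schMul, SchwartzMap.smulLeftCLM_apply_apply ha]

lemma schD_comm (i j : Fin 3) (f : Sch) : schD i (schD j f) = schD j (schD i f) := by
  ext x
  have h := (f.contDiffAt 2 (x := x)).isSymmSndFDerivAt (by simp)
  have key : ∀ i j : Fin 3, schD i (schD j f) x =
      fderiv ℝ (fderiv ℝ f) x (EuclideanSpace.single i 1) (EuclideanSpace.single j 1) := by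
    intro i j
    have hd : DifferentiableAt ℝ (fderiv ℝ f) x :=
      ((f.smooth 2).fderiv_right (m := 1) (by norm_num)).differentiable (by norm_num) x
    rw [schD_apply, pd]
    have : (fun y => schD j f y) = fun y => fderiv ℝ f y (EuclideanSpace.single j 1) := rfl
    change fderiv ℝ (fun y => fderiv ℝ f y (EuclideanSpace.single j 1)) x _ = _
    rw [fderiv_clm_apply hd (by fun_prop)]
    simp
  rw [key, key]
  exact h _ _

lemma schD_schMul {a : E3 → ℝ} (ha : a.HasTemperateGrowth) (hda : ∀ i, (pd a i).HasTemperateGrowth)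
    (i : Fin 3) (f : Sch) :
    schD i (schMul a f) = schMul (pd a i) f + schMul a (schD i f) := by
  ext x
  have hd : DifferentiableAt ℝ a x := (ha.1.differentiable (by simp)) x
  have h1 : ⇑(schMul a f) = fun y => a y * f y := funext (schMul_apply ha f)
  rw [schD_apply, pd, h1, fderiv_fun_mul hd f.differentiableAt]
  simp only [add_apply, schMul_apply ha, schMul_apply (hda i), schD_apply, pd]
  simp
  ring

/-- The `L²` pairing of the `j`-th order derivatives. -/
def sobPair : ℕ → Sch → Sch → ℝ
  | 0, f, g => ∫ x, f x * g x
  | j + 1, f, g => ∑ i, sobPair j (schD i f) (schD i g)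

lemma sch_integrable_mul (f g : Sch) : Integrable (fun x => f x * g x) := by
  have := (schMul f g).integrable (μ := volume)
  exact this.congr (.of_forall fun x => schMul_apply f.hasTemperateGrowth g x)

lemma sobPair_add_right (j : ℕ) (f g h : Sch) :
    sobPair j f (g + h) = sobPair j f g + sobPair j f h := by
  induction j generalizing f g h with
  | zero =>
    simp only [sobPair, add_apply, mul_add]
    exact integral_add (sch_integrable_mul _ _) (sch_integrable_mul _ _)
  | succ j ih => simp [sobPair, ih, Finset.sum_add_distrib]

lemma sobPair_smul_right (j : ℕ) (c : ℝ) (f g : Sch) :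
    sobPair j f (c • g) = c * sobPair j f g := by
  induction j generalizing f g with
  | zero =>
    simp only [sobPair, smul_apply, smul_eq_mul]
    rw [← integral_const_mul]
    congr 1; ext x; ring
  | succ j ih => simp [sobPair, ih, Finset.mul_sum]

lemma sobPair_comm (j : ℕ) (f g : Sch) : sobPair j f g = sobPair j g f := by
  induction j generalizing f g with
  | zero => simp only [sobPair, mul_comm]
  | succ j ih => simp only [sobPair, fun i => ih (schD i f) (schD i g)]

lemma sobPair_self_nonneg (j : ℕ) (f : Sch) : 0 ≤ sobPair j f f := by
  induction j generalizing f with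
  | zero => exact integral_nonneg fun x => mul_self_nonneg _
  | succ j ih => exact Finset.sum_nonneg fun i _ => ih _

/-- `sobPair j f` as a linear functional. -/
def sobPairLin (j : ℕ) (f : Sch) : Sch →ₗ[ℝ] ℝ where
  toFun := sobPair j f
  map_add' := sobPair_add_right j f
  map_smul' c g := sobPair_smul_right j c f g

lemma sobPair_sub_right (j : ℕ) (f g h : Sch) :
    sobPair j f (g - h) = sobPair j f g - sobPair j f h :=
  map_sub (sobPairLin j f) g h

lemma sobPair_sum_right {ι : Type*} (s : Finset ι) (j : ℕ) (f : Sch) (g : ι → Sch) :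
    sobPair j f (∑ i ∈ s, g i) = ∑ i ∈ s, sobPair j f (g i) :=
  map_sum (sobPairLin j f) g s

lemma two_mul_abs_sobPair_le (j : ℕ) (f g : Sch) :
    2 * |sobPair j f g| ≤ sobPair j f f + sobPair j g g := by
  have h1 := sobPair_self_nonneg j (f + g)
  have h2 := sobPair_self_nonneg j (f - g)
  rw [sobPair_add_right, sobPair_comm j _ f, sobPair_comm j _ g, sobPair_add_right,
    sobPair_add_right, sobPair_comm j g f] at h1
  rw [sobPair_sub_right, sobPair_comm j _ f, sobPair_comm j _ g, sobPair_sub_right,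
    sobPair_sub_right, sobPair_comm j g f] at h2
  rcases abs_cases (sobPair j f g) with h | h <;> linarith

lemma sobPair_add_self_le (j : ℕ) (f g : Sch) :
    sobPair j (f + g) (f + g) ≤ 2 * sobPair j f f + 2 * sobPair j g g := by
  have h2 := sobPair_self_nonneg j (f - g)
  rw [sobPair_add_right, sobPair_comm j _ f, sobPair_comm j _ g, sobPair_add_right,
    sobPair_add_right, sobPair_comm j g f]
  rw [sobPair_sub_right, sobPair_comm j _ f, sobPair_comm j _ g, sobPair_sub_right,
    sobPair_sub_right, sobPair_comm j g f] at h2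
  linarith

lemma pd_sch_hasTemperateGrowth (a : Sch) (i : Fin 3) : (pd a i).HasTemperateGrowth :=
  (schD i a).hasTemperateGrowth

/-- Multiplication by a Schwartz function is bounded for the Sobolev energies. -/
lemma sobPair_schMul_le (j : ℕ) (a : Sch) : ∃ C : ℝ, 0 ≤ C ∧ ∀ f : Sch,
    sobPair j (schMul a f) (schMul a f) ≤ C * ∑ l ∈ Finset.range (j + 1), sobPair l f f := by
  induction j generalizing a with
  | zero =>
    set M := SchwartzMap.seminorm ℝ 0 0 a
    refine ⟨M ^ 2, sq_nonneg _, fun f => ?_⟩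
    simp only [sobPair, zero_add, Finset.sum_range_one]
    rw [← integral_const_mul]
    refine integral_mono (sch_integrable_mul _ _) ((sch_integrable_mul _ _).const_mul _) fun x => ?_
    simp only [schMul_apply a.hasTemperateGrowth]
    have h1 : |a x| ≤ M := SchwartzMap.norm_le_seminorm ℝ a x
    have h2 : a x ^ 2 ≤ M ^ 2 :=
      sq_le_sq' (by linarith [neg_abs_le (a x)]) (le_trans (le_abs_self _) h1)
    nlinarith [mul_self_nonneg (f x)]
  | succ j ih =>
    choose C hC0 hC using ih
    refine ⟨2 * (∑ i, C (schD i a) + C a), by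
      have := Finset.sum_nonneg fun i (_ : i ∈ Finset.univ) => hC0 (schD i a)
      have := hC0 a
      positivity, fun f => ?_⟩
    have hle : ∑ l ∈ Finset.range (j + 1), sobPair l f f
        ≤ ∑ l ∈ Finset.range (j + 1 + 1), sobPair l f f := by
      rw [Finset.sum_range_succ _ (j + 1)]
      linarith [sobPair_self_nonneg (j + 1) f]
    have hle' : ∑ i, ∑ l ∈ Finset.range (j + 1), sobPair l (schD i f) (schD i f)
        ≤ ∑ l ∈ Finset.range (j + 1 + 1), sobPair l f f := by
      rw [Finset.sum_comm, Finset.sum_range_succ' _ (j + 1)]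
      exact le_add_of_nonneg_right (sobPair_self_nonneg 0 f)
    calc sobPair (j + 1) (schMul a f) (schMul a f)
        = ∑ i, sobPair j (schMul (schD i a) f + schMul a (schD i f))
            (schMul (schD i a) f + schMul a (schD i f)) := by
          simp only [sobPair]
          refine Finset.sum_congr rfl fun i _ => ?_
          rw [schD_schMul a.hasTemperateGrowth (pd_sch_hasTemperateGrowth a)]
          rfl
      _ ≤ ∑ i, (2 * (C (schD i a) * ∑ l ∈ Finset.range (j + 1), sobPair l f f)
            + 2 * (C a * ∑ l ∈ Finset.range (j + 1), sobPair l (schD i f) (schD i f))) := by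
          refine Finset.sum_le_sum fun i _ => ?_
          refine (sobPair_add_self_le _ _ _).trans ?_
          gcongr
          · exact hC _ _
          · exact hC _ _
      _ = 2 * ((∑ i, C (schD i a)) * ∑ l ∈ Finset.range (j + 1), sobPair l f f)
            + 2 * (C a * ∑ i, ∑ l ∈ Finset.range (j + 1), sobPair l (schD i f) (schD i f)) := by
          rw [Finset.sum_add_distrib, ← Finset.mul_sum, ← Finset.sum_mul, ← Finset.mul_sum,
            ← Finset.mul_sum]
      _ ≤ 2 * ((∑ i, C (schD i a)) * ∑ l ∈ Finset.range (j + 1 + 1), sobPair l f f)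
            + 2 * (C a * ∑ l ∈ Finset.range (j + 1 + 1), sobPair l f f) := by
          have := Finset.sum_nonneg fun i (_ : i ∈ Finset.univ) => hC0 (schD i a)
          have := hC0 a
          gcongr
      _ = _ := by ring

/-- The drift–diffusion generator as a continuous linear operator on Schwartz space. -/
def schL (u : Fin 3 → Sch) : Sch →L[ℝ] Sch :=
  (∑ i, schD i ∘L schD i) + (1 / 2 : ℝ) • ContinuousLinearMap.id ℝ Sch
    + (1 / 2 : ℝ) • (∑ i, schMul (fun x => x i) ∘L schD i) - ∑ i, schMul (u i) ∘L schD i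

lemma schL_apply (u : Fin 3 → Sch) (f : Sch) :
    schL u f = (∑ i, schD i (schD i f)) + (1 / 2 : ℝ) • f
      + (1 / 2 : ℝ) • (∑ i, schMul (fun x => x i) (schD i f)) - ∑ i, schMul (u i) (schD i f) := by
  simp [schL]

lemma coord_hasTemperateGrowth (i : Fin 3) : (fun x : E3 => x i).HasTemperateGrowth :=
  (EuclideanSpace.proj i : E3 →L[ℝ] ℝ).hasTemperateGrowth

lemma pd_coord (i j : Fin 3) : pd (fun x : E3 => x i) j = fun _ => if i = j then 1 else 0 := by
  ext x
  have : fderiv ℝ (fun x : E3 => x i) x = (EuclideanSpace.proj i : E3 →L[ℝ] ℝ) :=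
    (EuclideanSpace.proj i : E3 →L[ℝ] ℝ).hasFDerivAt.fderiv
  rw [pd, this]
  simp

lemma pd_coord_hasTemperateGrowth (i j : Fin 3) :
    (pd (fun x : E3 => x i) j).HasTemperateGrowth := by
  rw [pd_coord]; fun_prop

lemma schMul_pd_coord (i j : Fin 3) (f : Sch) :
    schMul (pd (fun x : E3 => x i) j) f = if i = j then f else 0 := by
  ext x
  rw [schMul_apply (pd_coord_hasTemperateGrowth i j), pd_coord]
  split_ifs <;> simp

lemma sobPair_zero_schMul {a : E3 → ℝ} (ha : a.HasTemperateGrowth) (f g : Sch) :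
    sobPair 0 f (schMul a g) = sobPair 0 (schMul a f) g := by
  simp only [sobPair, schMul_apply ha]
  congr 1; ext x; ring

lemma sobPair_zero_schD (i : Fin 3) (f g : Sch) :
    sobPair 0 f (schD i g) = -sobPair 0 (schD i f) g :=
  SchwartzMap.integral_mul_lineDerivOp_right_eq_neg_left f g _

lemma two_mul_sobPair_zero_transport {a : E3 → ℝ} (ha : a.HasTemperateGrowth)
    (hda : ∀ i, (pd a i).HasTemperateGrowth) (i : Fin 3) (f : Sch) :
    2 * sobPair 0 f (schMul a (schD i f)) = -sobPair 0 f (schMul (pd a i) f) := by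
  have h : sobPair 0 f (schMul a (schD i f))
      = -(sobPair 0 f (schMul (pd a i) f) + sobPair 0 f (schMul a (schD i f))) := by
    conv_lhs => rw [sobPair_zero_schMul ha, sobPair_zero_schD, sobPair_comm, schD_schMul ha hda,
      sobPair_add_right]
  linarith

/-- The `L²` energy inequality. -/
lemma sobPair_zero_schL_le (u : Fin 3 → Sch) (hu : ∀ x, ∑ i, pd (u i) i x = 0) (f : Sch) :
    sobPair 0 f (schL u f) ≤ -sobPair 1 f f := by
  have h1 : sobPair 0 f (∑ i, schD i (schD i f)) = -sobPair 1 f f := by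
    rw [sobPair_sum_right]
    simp only [sobPair_zero_schD _ f, Finset.sum_neg_distrib]
    rfl
  have h2 : 2 * sobPair 0 f (∑ i, schMul (fun x => x i) (schD i f)) = -(3 * sobPair 0 f f) := by
    rw [sobPair_sum_right, Finset.mul_sum]
    simp only [two_mul_sobPair_zero_transport (coord_hasTemperateGrowth _)
      (pd_coord_hasTemperateGrowth _), schMul_pd_coord]
    simp
  have h3 : 2 * sobPair 0 f (∑ i, schMul (u i) (schD i f)) = 0 := by
    rw [sobPair_sum_right, Finset.mul_sum]
    simp only [two_mul_sobPair_zero_transport (u _).hasTemperateGrowth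
      (pd_sch_hasTemperateGrowth _)]
    rw [Finset.sum_neg_distrib, ← sobPair_sum_right]
    have : ∑ i, schMul (pd (u i) i) f = 0 := by
      ext x
      simp only [sum_apply, schMul_apply (pd_sch_hasTemperateGrowth (u _) _), ← Finset.sum_mul,
        hu, zero_mul]
      rfl
    rw [this, neg_eq_zero]
    exact map_zero (sobPairLin 0 f)
  rw [schL_apply, sobPair_sub_right, sobPair_add_right, sobPair_add_right, sobPair_smul_right,
    sobPair_smul_right, h1]
  linarith [sobPair_self_nonneg 0 f]

lemma schD_schL (u : Fin 3 → Sch) (i : Fin 3) (f : Sch) :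
    schD i (schL u f) = schL u (schD i f) + (1 / 2 : ℝ) • schD i f
      - ∑ k, schMul (schD i (u k)) (schD k f) := by
  have hc : ∀ k, schD i (schMul (fun x => x k) (schD k f))
      = (if k = i then schD k f else 0) + schMul (fun x => x k) (schD k (schD i f)) := fun k => by
    rw [schD_schMul (coord_hasTemperateGrowth k) (pd_coord_hasTemperateGrowth k), schMul_pd_coord,
      schD_comm]
  have hm : ∀ k, schD i (schMul (u k) (schD k f))
      = schMul (schD i (u k)) (schD k f) + schMul (u k) (schD k (schD i f)) := fun k => by
    rw [schD_schMul (u k).hasTemperateGrowth (pd_sch_hasTemperateGrowth (u k)), schD_comm i k]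
    rfl
  have hl : ∀ k, schD i (schD k (schD k f)) = schD k (schD k (schD i f)) := fun k => by
    rw [schD_comm i k, schD_comm i k]
  simp only [schL_apply, map_add, map_sub, map_smul, map_sum, hc, hm, hl, Finset.sum_add_distrib,
    Finset.sum_ite_eq', Finset.mem_univ, if_true, smul_add]
  abel

/-- The energy inequality for the derivatives of order `j`. -/
lemma sobPair_schL_le (u : Fin 3 → Sch) (hu : ∀ x, ∑ i, pd (u i) i x = 0) (j : ℕ) :
    ∃ C : ℝ, 0 ≤ C ∧ ∀ f : Sch, sobPair j f (schL u f) ≤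
      -sobPair (j + 1) f f + C * ∑ l ∈ Finset.range j, sobPair (l + 1) f f := by
  induction j with
  | zero => exact ⟨0, le_rfl, fun f => by simpa using sobPair_zero_schL_le u hu f⟩
  | succ j ih =>
    obtain ⟨C, hC0, hC⟩ := ih
    choose K hK0 hK using fun i k => sobPair_schMul_le j (schD i (u k))
    set T : Sch → ℝ := fun f => ∑ l ∈ Finset.range (j + 1), sobPair (l + 1) f f with hT
    have hTd : ∀ f, T f = ∑ k, ∑ l ∈ Finset.range (j + 1), sobPair l (schD k f) (schD k f) :=
      fun f => Finset.sum_comm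
    have hTk : ∀ f k, ∑ l ∈ Finset.range (j + 1), sobPair l (schD k f) (schD k f) ≤ T f :=
      fun f k => by
        rw [hTd]
        exact Finset.single_le_sum (f := fun k => ∑ l ∈ Finset.range (j + 1),
          sobPair l (schD k f) (schD k f)) (fun k _ => Finset.sum_nonneg fun l _ =>
            sobPair_self_nonneg _ _) (Finset.mem_univ k)
    have hTj : ∀ f k, sobPair j (schD k f) (schD k f) ≤ T f := fun f k =>
      (Finset.single_le_sum (f := fun l => sobPair l (schD k f) (schD k f))
        (fun l _ => sobPair_self_nonneg _ _) (Finset.self_mem_range_succ j)).trans (hTk f k)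
    have hT1 : ∀ f i, ∑ l ∈ Finset.range j, sobPair (l + 1) (schD i f) (schD i f) ≤ T f :=
      fun f i => by
        refine le_trans ?_ (hTk f i)
        rw [Finset.sum_range_succ' _ j]
        exact le_add_of_nonneg_right (sobPair_self_nonneg 0 _)
    refine ⟨∑ i, (C + 1 / 2 + ∑ k, (1 / 2) * (1 + K i k)),
      Finset.sum_nonneg fun i _ => by
        have := Finset.sum_nonneg fun k (_ : k ∈ Finset.univ) => hK0 i k
        have : ∀ k, 0 ≤ (1 / 2) * (1 + K i k) := fun k => by linarith [hK0 i k]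
        have := Finset.sum_nonneg fun k (_ : k ∈ Finset.univ) => this k
        linarith, fun f => ?_⟩
    have hterm : ∀ i, sobPair j (schD i f) (schD i (schL u f)) ≤
        -sobPair (j + 1) (schD i f) (schD i f)
          + (C + 1 / 2 + ∑ k, (1 / 2) * (1 + K i k)) * T f := fun i => by
      rw [schD_schL, sobPair_sub_right, sobPair_add_right, sobPair_smul_right, sobPair_sum_right]
      have h1 := hC (schD i f)
      have h2 := mul_le_mul_of_nonneg_left (hT1 f i) hC0
      have h3 := hTj f i
      have h4 : -∑ k, sobPair j (schD i f) (schMul (schD i (u k)) (schD k f))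
          ≤ (∑ k, (1 / 2) * (1 + K i k)) * T f := by
        rw [← Finset.sum_neg_distrib, Finset.sum_mul]
        refine Finset.sum_le_sum fun k _ => ?_
        have a1 := two_mul_abs_sobPair_le j (schD i f) (schMul (schD i (u k)) (schD k f))
        have a2 := hK i k (schD k f)
        have a3 := mul_le_mul_of_nonneg_left (hTk f k) (hK0 i k)
        have a4 := neg_abs_le (sobPair j (schD i f) (schMul (schD i (u k)) (schD k f)))
        linarith
      linarith
    calc sobPair (j + 1) f (schL u f)
        ≤ ∑ i, (-sobPair (j + 1) (schD i f) (schD i f)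
          + (C + 1 / 2 + ∑ k, (1 / 2) * (1 + K i k)) * T f) :=
          Finset.sum_le_sum fun i _ => hterm i
      _ = _ := by
          rw [Finset.sum_add_distrib, Finset.sum_neg_distrib, ← Finset.sum_mul]
          rfl

lemma sch_integrable_norm_iteratedFDeriv_sq (j : ℕ) (f : Sch) :
    Integrable (fun x => ‖iteratedFDeriv ℝ j f x‖ ^ 2) := by
  have h1 : Integrable (fun x => ‖iteratedFDeriv ℝ j f x‖) := by
    simpa using f.integrable_pow_mul_iteratedFDeriv volume 0 j
  have hcont : Continuous (fun x => ‖iteratedFDeriv ℝ j f x‖ ^ 2) :=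
    (((f.smooth j).continuous_iteratedFDeriv le_rfl).norm.pow 2)
  refine (h1.const_mul (SchwartzMap.seminorm ℝ 0 j f)).mono' hcont.aestronglyMeasurable
    (.of_forall fun x => ?_)
  rw [Real.norm_of_nonneg (by positivity), sq]
  exact mul_le_mul_of_nonneg_right (SchwartzMap.norm_iteratedFDeriv_le_seminorm ℝ f j x)
    (norm_nonneg _)

lemma norm_iteratedFDeriv_schD_le (j : ℕ) (i : Fin 3) (f : Sch) (x : E3) :
    ‖iteratedFDeriv ℝ j (schD i f) x‖ ≤ ‖iteratedFDeriv ℝ (j + 1) f x‖ := by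
  rw [← norm_iteratedFDeriv_fderiv]
  have h : ‖iteratedFDeriv ℝ j (schD i f) x‖ ≤ ‖(EuclideanSpace.single i (1 : ℝ) : E3)‖ *
      ‖iteratedFDeriv ℝ j (fderiv ℝ f) x‖ :=
    norm_iteratedFDeriv_clm_apply_const (𝕜 := ℝ) (f := fderiv ℝ f)
    (c := (EuclideanSpace.single i (1 : ℝ) : E3)) (x := x) (N := (j : ℕ∞)) (n := j)
    ((f.smooth (j + 1)).fderiv_right (by simp)).contDiffAt le_rfl
  simpa using h

lemma norm_iteratedFDeriv_succ_le (j : ℕ) (f : Sch) (x : E3) :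
    ‖iteratedFDeriv ℝ (j + 1) f x‖ ≤ ∑ i, ‖iteratedFDeriv ℝ j (schD i f) x‖ := by
  set P : Fin 3 → E3 →L[ℝ] ℝ := fun i => EuclideanSpace.proj i with hP
  set T : Fin 3 → ℝ →L[ℝ] (E3 →L[ℝ] ℝ) := fun i =>
    ContinuousLinearMap.smulRight (1 : ℝ →L[ℝ] ℝ) (P i) with hT
  have hPn : ∀ i, ‖P i‖ ≤ 1 := fun i =>
    ContinuousLinearMap.opNorm_le_bound _ zero_le_one fun y => by
      rw [one_mul]; exact PiLp.norm_apply_le y i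
  have hTn : ∀ i, ‖T i‖ ≤ 1 := fun i => by
    simpa [hT, ContinuousLinearMap.norm_smulRight_apply] using hPn i
  have hf : fderiv ℝ f = fun y => ∑ i, (T i ∘ schD i f) y := by
    ext y v
    have hv : v = ∑ i, v i • (EuclideanSpace.single i (1 : ℝ) : E3) := by
      ext k; fin_cases k <;> simp [Fin.sum_univ_three]
    conv_lhs => rw [hv]
    simp [hT, hP, schD_apply, pd, mul_comm]
  have hs : ∀ i, ContDiff ℝ (j : ℕ∞) (T i ∘ schD i f) := fun i =>
    (T i).contDiff.comp ((schD i f).smooth j)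
  rw [← norm_iteratedFDeriv_fderiv, hf,
    iteratedFDeriv_fun_sum_apply fun i _ => (hs i).contDiffAt]
  refine (norm_sum_le _ _).trans (Finset.sum_le_sum fun i _ => ?_)
  refine ((T i).norm_iteratedFDeriv_comp_left (((schD i f).smooth j).contDiffAt) le_rfl).trans ?_
  exact mul_le_of_le_one_left (norm_nonneg _) (hTn i)

lemma sobPair_self_le_integral (j : ℕ) (f : Sch) :
    sobPair j f f ≤ 3 ^ j * ∫ x, ‖iteratedFDeriv ℝ j f x‖ ^ 2 := by
  induction j generalizing f with
  | zero => simp [sobPair, ← sq]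
  | succ j ih =>
    calc sobPair (j + 1) f f
        ≤ ∑ _i : Fin 3, 3 ^ j * ∫ x, ‖iteratedFDeriv ℝ (j + 1) f x‖ ^ 2 := by
          refine Finset.sum_le_sum fun i _ => (ih _).trans ?_
          refine mul_le_mul_of_nonneg_left ?_ (by positivity)
          refine integral_mono (sch_integrable_norm_iteratedFDeriv_sq j (schD i f))
            (sch_integrable_norm_iteratedFDeriv_sq (j + 1) f) fun x => ?_
          exact pow_le_pow_left₀ (norm_nonneg _) (norm_iteratedFDeriv_schD_le j i f x) 2
      _ = _ := by simp [pow_succ]; ring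

lemma integral_le_sobPair_self (j : ℕ) (f : Sch) :
    ∫ x, ‖iteratedFDeriv ℝ j f x‖ ^ 2 ≤ 3 ^ j * sobPair j f f := by
  induction j generalizing f with
  | zero => simp [sobPair, ← sq]
  | succ j ih =>
    calc ∫ x, ‖iteratedFDeriv ℝ (j + 1) f x‖ ^ 2
        ≤ ∫ x, 3 * ∑ i, ‖iteratedFDeriv ℝ j (schD i f) x‖ ^ 2 := by
          refine integral_mono (sch_integrable_norm_iteratedFDeriv_sq (j + 1) f)
            ((integrable_finsetSum _ fun i _ =>
              sch_integrable_norm_iteratedFDeriv_sq j (schD i f)).const_mul _) fun x => ?_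
          refine (pow_le_pow_left₀ (norm_nonneg _) (norm_iteratedFDeriv_succ_le j f x) 2).trans ?_
          simpa using sq_sum_le_card_mul_sum_sq (s := (Finset.univ : Finset (Fin 3)))
            (f := fun i => ‖iteratedFDeriv ℝ j (schD i f) x‖)
      _ = 3 * ∑ i, ∫ x, ‖iteratedFDeriv ℝ j (schD i f) x‖ ^ 2 := by
          rw [integral_const_mul, integral_finsetSum _ fun i _ =>
            sch_integrable_norm_iteratedFDeriv_sq j (schD i f)]
      _ ≤ 3 * ∑ i, 3 ^ j * sobPair j (schD i f) (schD i f) := by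
          gcongr with i
          exact ih _
      _ = _ := by rw [← Finset.mul_sum, pow_succ]; simp only [sobPair]; ring

lemma sch_decay_of_isVonNBounded {B : Set Sch} (hB : Bornology.IsVonNBounded ℝ B) :
    ∃ C : ℝ, 0 ≤ C ∧ ∀ f ∈ B, ∀ x, |f x| ≤ C * (1 + ‖x‖) ^ (-2 : ℝ) := by
  obtain ⟨r, hr, h⟩ := ((schwartz_withSeminorms ℝ E3 ℝ).isVonNBounded_iff_finset_seminorm_bounded.1
    hB) (Finset.Iic (2, 0))
  refine ⟨2 ^ 2 * r, by positivity, fun f hf x => ?_⟩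
  have h1 := SchwartzMap.one_add_le_sup_seminorm_apply (𝕜 := ℝ) (m := (2, 0)) (k := 2) (n := 0)
    le_rfl le_rfl f x
  rw [norm_iteratedFDeriv_zero] at h1
  have h2 := (h f hf).le
  have hx : (0 : ℝ) < (1 + ‖x‖) ^ 2 := by positivity
  rw [Real.rpow_neg (by positivity), ← div_eq_mul_inv, show (2 : ℝ) = ((2 : ℕ) : ℝ) by norm_num,
    Real.rpow_natCast, le_div_iff₀ hx, mul_comm]
  refine h1.trans ?_
  push_cast
  gcongr
  exact h2

/-- A curve `F` of Schwartz functions, jointly smooth on `τ ≥ 0` and locally bounded, whose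
pointwise time derivative is the locally bounded curve `G`. -/
structure SchEvol (F G : ℝ → Sch) : Prop where
  smooth : ContDiffOn ℝ (⊤ : ℕ∞) (fun q : E3 × ℝ => F q.2 q.1) (Set.univ ×ˢ Set.Ici 0)
  hasDerivAt : ∀ s, 0 < s → ∀ x, HasDerivAt (fun t => F t x) (G s x) s
  bdd : ∀ b, Bornology.IsVonNBounded ℝ (F '' Set.Icc 0 b)
  bdd_deriv : ∀ b, Bornology.IsVonNBounded ℝ (G '' Set.Icc 0 b)

namespace SchEvol

lemma uniqueDiffOn_halfspace : UniqueDiffOn ℝ ((Set.univ : Set E3) ×ˢ Set.Ici (0 : ℝ)) :=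
  uniqueDiffOn_univ.prod (uniqueDiffOn_Ici 0)

lemma schD {F G : ℝ → Sch} (h : SchEvol F G) (i : Fin 3) :
    SchEvol (fun s => schD i (F s)) (fun s => schD i (G s)) := by
  set S : Set (E3 × ℝ) := Set.univ ×ˢ Set.Ici 0 with hS
  set Φ : E3 × ℝ → ℝ := fun q => F q.2 q.1 with hΦ
  set e : E3 := EuclideanSpace.single i 1 with he
  have hslice : ∀ q ∈ S, _root_.schD i (F q.2) q.1 = fderivWithin ℝ Φ S q (e, 0) := by
    rintro ⟨x, s⟩ hq
    have h1 : HasFDerivWithinAt Φ (fderivWithin ℝ Φ S (x, s)) S (x, s) :=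
      (h.smooth.differentiableOn (by simp) _ hq).hasFDerivWithinAt
    have h2 : HasFDerivAt (fun y : E3 => (y, s)) (ContinuousLinearMap.inl ℝ E3 ℝ) x :=
      hasFDerivAt_prodMk_left x s
    have h3 := HasFDerivWithinAt.comp_hasFDerivAt (f := fun y : E3 => (y, s)) x h1 h2
      (Filter.Eventually.of_forall fun y : E3 => (⟨Set.mem_univ y, hq.2⟩ : (y, s) ∈ S))
    have h4 : fderiv ℝ (F s) x = _ := h3.fderiv
    rw [schD_apply, pd, h4]
    simp
    rfl
  refine ⟨?_, ?_, fun b => ?_, fun b => ?_⟩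
  · have h1 : ContDiffOn ℝ (⊤ : ℕ∞) (fderivWithin ℝ Φ S) S :=
      h.smooth.fderivWithin uniqueDiffOn_halfspace (by simp)
    exact (h1.clm_apply contDiffOn_const).congr hslice
  · intro s hs x
    have hnhds : ∀ y : E3, ∀ t : ℝ, 0 < t → S ∈ nhds (y, t) := fun y t ht =>
      prod_mem_nhds Filter.univ_mem (Ici_mem_nhds ht)
    have hsm : ∀ y : E3, ∀ t : ℝ, 0 < t → ContDiffAt ℝ (⊤ : ℕ∞) Φ (y, t) := fun y t ht =>
      h.smooth.contDiffAt (hnhds y t ht)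
    have hsym := (hsm x s hs).isSymmSndFDerivAt (by
      rw [minSmoothness_of_isRCLikeNormedField]; exact WithTop.coe_le_coe.2 le_top)
    have hdd : DifferentiableAt ℝ (fderiv ℝ Φ) (x, s) :=
      ((hsm x s hs).fderiv_right (m := 1) (WithTop.coe_le_coe.2 le_top)).differentiableAt (by simp)
    have hG : ∀ y, G s y = fderiv ℝ Φ (y, s) (0, 1) := by
      intro y
      have h1 := ((hsm y s hs).differentiableAt (by simp)).hasFDerivAt
      have h2 : HasDerivAt (fun t : ℝ => (y, t)) ((0 : E3), (1 : ℝ)) s :=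
        (hasDerivAt_const s y).prodMk (hasDerivAt_id s)
      exact (h.hasDerivAt s hs y).unique (h1.comp_hasDerivAt s h2)
    have hd1 : HasDerivAt (fun t => fderiv ℝ Φ (x, t) (e, 0))
        (fderiv ℝ (fderiv ℝ Φ) (x, s) (0, 1) (e, 0)) s := by
      have h2 : HasDerivAt (fun t : ℝ => (x, t)) ((0 : E3), (1 : ℝ)) s :=
        (hasDerivAt_const s x).prodMk (hasDerivAt_id s)
      have h3 := hdd.hasFDerivAt.comp_hasDerivAt s h2
      have h4 := h3.clm_apply (hasDerivAt_const s ((e, 0) : E3 × ℝ))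
      simpa using h4
    have hd2 : _root_.schD i (G s) x = fderiv ℝ (fderiv ℝ Φ) (x, s) (e, 0) (0, 1) := by
      have h2 : HasFDerivAt (fun y : E3 => (y, s)) (ContinuousLinearMap.inl ℝ E3 ℝ) x :=
        hasFDerivAt_prodMk_left x s
      have h3 := hdd.hasFDerivAt.comp x h2
      have h4 : HasFDerivAt (fun y => fderiv ℝ Φ (y, s) (0, 1)) _ x :=
        h3.clm_apply (hasFDerivAt_const ((0, 1) : E3 × ℝ) x)
      have h5 : (G s : E3 → ℝ) = fun y => fderiv ℝ Φ (y, s) (0, 1) := funext hG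
      rw [schD_apply, pd, h5, HasFDerivAt.fderiv h4]
      simp
      rfl
    rw [hd2, hsym.eq]
    refine hd1.congr_of_eventuallyEq ?_
    filter_upwards [Ioi_mem_nhds hs] with t ht
    rw [← fderivWithin_of_mem_nhds (hnhds x t ht)]
    exact hslice (x, t) ⟨Set.mem_univ _, (le_of_lt ht : 0 ≤ t)⟩
  · simpa only [Set.image_image] using (h.bdd b).image (_root_.schD i)
  · simpa only [Set.image_image] using (h.bdd_deriv b).image (_root_.schD i)

lemma exists_dominating {F G : ℝ → Sch} {b : ℝ}
    (hF : Bornology.IsVonNBounded ℝ (F '' Set.Icc 0 b))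
    (hG : Bornology.IsVonNBounded ℝ (G '' Set.Icc 0 b)) :
    ∃ B : E3 → ℝ, Integrable B ∧ ∀ s ∈ Set.Icc 0 b, ∀ x, |F s x * G s x| ≤ B x := by
  obtain ⟨C, hC, hFC⟩ := sch_decay_of_isVonNBounded hF
  obtain ⟨K, hK, hGK⟩ := sch_decay_of_isVonNBounded hG
  refine ⟨fun x => (C * K) * (1 + ‖x‖) ^ (-4 : ℝ),
    (integrable_one_add_norm (by simp; norm_num)).const_mul _, fun s hs x => ?_⟩
  have h1 := hFC _ (Set.mem_image_of_mem F hs) x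
  have h2 := hGK _ (Set.mem_image_of_mem G hs) x
  have h3 : ((1 : ℝ) + ‖x‖) ^ (-4 : ℝ) = (1 + ‖x‖) ^ (-2 : ℝ) * (1 + ‖x‖) ^ (-2 : ℝ) := by
    rw [← Real.rpow_add (by positivity)]; norm_num
  rw [abs_mul]
  beta_reduce
  rw [h3]
  calc _ ≤ (C * (1 + ‖x‖) ^ (-2 : ℝ)) * (K * (1 + ‖x‖) ^ (-2 : ℝ)) := by gcongr
    _ = _ := by ring

lemma hasDerivAt_sobPair {F G : ℝ → Sch} (h : SchEvol F G) (j : ℕ) (s : ℝ) (hs : 0 < s) :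
    HasDerivAt (fun t => sobPair j (F t) (F t)) (2 * sobPair j (F s) (G s)) s := by
  induction j generalizing F G with
  | zero =>
    obtain ⟨B, hB, hBd⟩ := exists_dominating (h.bdd (s + 1)) (h.bdd_deriv (s + 1))
    have key := (hasDerivAt_integral_of_dominated_loc_of_deriv_le (μ := (volume : Measure E3))
      (F := fun t x => F t x * F t x) (F' := fun t x => 2 * (F t x * G t x)) (x₀ := s)
      (s := Set.Ioo 0 (s + 1)) (bound := fun x => 2 * B x) (Ioo_mem_nhds hs (by linarith))
      (.of_forall fun t => ((F t).continuous.mul (F t).continuous).aestronglyMeasurable)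
      (sch_integrable_mul _ _)
      ((((F s).continuous.mul (G s).continuous).const_smul (2 : ℝ)).aestronglyMeasurable)
      (.of_forall fun x t ht => by
        rw [Real.norm_eq_abs, abs_mul, abs_two]
        exact mul_le_mul_of_nonneg_left (hBd t ⟨ht.1.le, ht.2.le⟩ x) zero_le_two)
      (hB.const_mul 2)
      (.of_forall fun x t ht => by
        exact ((h.hasDerivAt t ht.1 x).mul (h.hasDerivAt t ht.1 x)).congr_deriv (by ring))).2
    rw [integral_const_mul] at key
    exact key
  | succ j ih =>
    simp only [sobPair]
    rw [Finset.mul_sum]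
    exact HasDerivAt.fun_sum fun i _ => ih (h.schD i)

lemma continuousOn_sobPair {F G : ℝ → Sch} (h : SchEvol F G) (j : ℕ) :
    ContinuousOn (fun t => sobPair j (F t) (F t)) (Set.Ici 0) := by
  induction j generalizing F G with
  | zero =>
    intro s hs
    obtain ⟨B, hB, hBd⟩ := exists_dominating (h.bdd (s + 1)) (h.bdd (s + 1))
    refine continuousWithinAt_of_dominated (bound := B)
      (.of_forall fun t => ((F t).continuous.mul (F t).continuous).aestronglyMeasurable) ?_ hB
      (.of_forall fun x => ?_)
    · filter_upwards [self_mem_nhdsWithin, nhdsWithin_le_nhds (Iic_mem_nhds (lt_add_one s))]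
        with t ht ht'
      exact .of_forall fun x => hBd t ⟨ht, ht'⟩ x
    · have h1 : ContinuousWithinAt (fun t => F t x) (Set.Ici 0) s :=
        ContinuousWithinAt.comp (g := fun q : E3 × ℝ => F q.2 q.1) (f := fun t => (x, t))
          (h.smooth.continuousOn (x, s) ⟨Set.mem_univ _, hs⟩) (by fun_prop)
          (fun t ht => ⟨Set.mem_univ _, ht⟩)
      exact h1.mul h1
  | succ j ih =>
    simp only [sobPair]
    exact continuousOn_finsetSum _ fun i _ => ih (h.schD i)

end SchEvol

lemma hasDerivAt_div_one_add (s : ℝ) (hs : 0 < s) :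
    HasDerivAt (fun t : ℝ => t / (1 + t)) (1 / (1 + s) ^ 2) s := by
  have hne : (1 : ℝ) + s ≠ 0 := by positivity
  have h := (hasDerivAt_id s).div ((hasDerivAt_id s).const_add 1) hne
  refine h.congr_deriv ?_
  simp

/-- A hierarchy of energies, each dissipated by the next one up to lower-order terms, has a
nonincreasing time-weighted combination. -/
lemma antitoneOn_weighted_energy (k m : ℕ) (E E' : ℕ → ℝ → ℝ) (C : ℕ → ℝ) (hC : ∀ j, 0 ≤ C j)
    (hE : ∀ j s, 0 ≤ E j s) (hcont : ∀ j, ContinuousOn (E j) (Set.Ici 0))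
    (hd : ∀ j s, 0 < s → HasDerivAt (E j) (E' j s) s)
    (hle : ∀ j s, E' j s ≤ -2 * E (j + 1) s + C j * ∑ l ∈ Finset.range j, E (l + 1) s) :
    AntitoneOn (fun s => ∑ j ∈ Finset.range (k + 1),
      (k + 1 + ∑ i ∈ Finset.range (k + 1), C i) ^ (k - j) * (s / (1 + s)) ^ (j - m) * E j s)
      (Set.Ici 0) := by
  set M : ℝ := k + 1 + ∑ i ∈ Finset.range (k + 1), C i with hM
  have hCs : 0 ≤ ∑ i ∈ Finset.range (k + 1), C i := Finset.sum_nonneg fun i _ => hC i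
  have hM1 : 1 ≤ M := by
    have : (0 : ℝ) ≤ k := k.cast_nonneg
    linarith
  set w : ℕ → ℝ → ℝ := fun j s => M ^ (k - j) * (s / (1 + s)) ^ (j - m) with hw
  set w' : ℕ → ℝ → ℝ := fun j s =>
    M ^ (k - j) * (((j - m : ℕ) : ℝ) * (s / (1 + s)) ^ (j - m - 1) * (1 / (1 + s) ^ 2)) with hw'
  have hwd : ∀ j s, 0 < s → HasDerivAt (w j) (w' j s) s := fun j s hs =>
    ((hasDerivAt_div_one_add s hs).pow (j - m)).const_mul _
  have hder : ∀ s, 0 < s → HasDerivAt (fun s => ∑ j ∈ Finset.range (k + 1), w j s * E j s)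
      (∑ j ∈ Finset.range (k + 1), (w' j s * E j s + w j s * E' j s)) s := fun s hs =>
    HasDerivAt.fun_sum fun j _ => (hwd j s hs).mul (hd j s hs)
  refine antitoneOn_of_deriv_nonpos (convex_Ici 0) ?_ ?_ ?_
  · refine continuousOn_finsetSum _ fun j _ => ContinuousOn.mul ?_ (hcont j)
    refine continuousOn_const.mul (ContinuousOn.pow ?_ _)
    refine continuousOn_id.div (by fun_prop) fun s hs => ?_
    have : (0 : ℝ) ≤ s := hs
    positivity
  · rw [interior_Ici]
    exact fun s hs => (hder s hs).differentiableAt.differentiableWithinAt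
  · rw [interior_Ici]
    intro s hs
    have hs : 0 < s := hs
    rw [(hder s hs).deriv]
    have hθ0 : 0 ≤ s / (1 + s) := by positivity
    have hθ1 : s / (1 + s) ≤ 1 := (div_le_one (by positivity)).2 (by linarith)
    have hw0 : ∀ j, 0 ≤ w j s := fun j => by positivity
    have hwmono : ∀ l j, l < j → j ≤ k → M * w j s ≤ w l s := fun l j hlj hjk => by
      have h1 : M * M ^ (k - j) ≤ M ^ (k - l) := by
        rw [← pow_succ']
        exact pow_le_pow_right₀ hM1 (by omega)
      have h2 : (s / (1 + s)) ^ (j - m) ≤ (s / (1 + s)) ^ (l - m) :=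
        pow_le_pow_of_le_one hθ0 hθ1 (by omega)
      calc M * w j s = (M * M ^ (k - j)) * (s / (1 + s)) ^ (j - m) := by rw [hw]; ring
        _ ≤ M ^ (k - l) * (s / (1 + s)) ^ (l - m) := by gcongr
    have hw'le : ∀ i, i + 1 ≤ k → M * w' (i + 1) s ≤ k * w i s := fun i hi => by
      have h1 : M * M ^ (k - (i + 1)) = M ^ (k - i) := by
        rw [← pow_succ']
        congr 1; omega
      have h2 : i + 1 - m - 1 = i - m := by omega
      have h3 : ((i + 1 - m : ℕ) : ℝ) ≤ k := by exact_mod_cast (by omega : i + 1 - m ≤ k)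
      have h4 : 1 / (1 + s) ^ 2 ≤ 1 := by
        rw [div_le_one (by positivity)]; nlinarith
      calc M * w' (i + 1) s = M ^ (k - i) * (((i + 1 - m : ℕ) : ℝ) * (s / (1 + s)) ^ (i - m)
            * (1 / (1 + s) ^ 2)) := by rw [← h1, ← h2, hw']; ring
        _ ≤ M ^ (k - i) * (k * (s / (1 + s)) ^ (i - m) * 1) := by gcongr
        _ = k * w i s := by rw [hw]; ring
    set W : ℝ := ∑ j ∈ Finset.range (k + 1), w j s * E (j + 1) s with hWdef
    have hterm0 : ∀ j, 0 ≤ w j s * E (j + 1) s := fun j => mul_nonneg (hw0 j) (hE _ _)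
    have hW0 : 0 ≤ W := Finset.sum_nonneg fun j _ => hterm0 j
    have hA : M * ∑ j ∈ Finset.range (k + 1), w' j s * E j s ≤ k * W := by
      rw [Finset.sum_range_succ']
      have : w' 0 s = 0 := by simp [hw']
      rw [this, zero_mul, add_zero, Finset.mul_sum, hWdef, Finset.sum_range_succ, mul_add,
        Finset.mul_sum]
      refine le_add_of_le_of_nonneg (Finset.sum_le_sum fun i hi => ?_)
        (mul_nonneg k.cast_nonneg (hterm0 k))
      have h5 := mul_le_mul_of_nonneg_right (hw'le i (by simpa using hi)) (hE (i + 1) s)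
      calc M * (w' (i + 1) s * E (i + 1) s) = M * w' (i + 1) s * E (i + 1) s :=
            (mul_assoc _ _ _).symm
        _ ≤ k * w i s * E (i + 1) s := h5
        _ = k * (w i s * E (i + 1) s) := mul_assoc _ _ _
    have hB : ∀ j ∈ Finset.range (k + 1),
        M * (w j s * E' j s) ≤ -2 * M * (w j s * E (j + 1) s) + C j * W := fun j hj => by
      have hjk : j ≤ k := Nat.lt_succ_iff.1 (Finset.mem_range.1 hj)
      have h1 : M * (w j s * ∑ l ∈ Finset.range j, E (l + 1) s) ≤ W := by
        rw [← mul_assoc, Finset.mul_sum]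
        refine (Finset.sum_le_sum fun l hl => mul_le_mul_of_nonneg_right
          (hwmono l j (Finset.mem_range.1 hl) hjk) (hE _ _)).trans ?_
        exact Finset.sum_le_sum_of_subset_of_nonneg
          (Finset.range_subset_range.2 (by omega)) fun l _ _ => hterm0 l
      have h2 := mul_le_mul_of_nonneg_left (hle j s) (mul_nonneg (by linarith : 0 ≤ M) (hw0 j))
      have h3 := mul_le_mul_of_nonneg_left h1 (hC j)
      linarith
    have hB' : M * ∑ j ∈ Finset.range (k + 1), w j s * E' j s
        ≤ -2 * M * W + (∑ j ∈ Finset.range (k + 1), C j) * W := by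
      rw [Finset.mul_sum]
      refine (Finset.sum_le_sum hB).trans (le_of_eq ?_)
      rw [Finset.sum_add_distrib, ← Finset.mul_sum, ← Finset.sum_mul]
    rw [Finset.sum_add_distrib]
    have hMW : (k + ∑ j ∈ Finset.range (k + 1), C j) * W ≤ M * W :=
      mul_le_mul_of_nonneg_right (by linarith) hW0
    have : 0 ≤ M * W := by positivity
    refine nonpos_of_mul_nonpos_right (a := M) ?_ (by linarith)
    linarith

lemma sum_energy_le (k m : ℕ) (hmk : m ≤ k) (E E' : ℕ → ℝ → ℝ) (C : ℕ → ℝ) (hC : ∀ j, 0 ≤ C j)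
    (hE : ∀ j s, 0 ≤ E j s) (hcont : ∀ j, ContinuousOn (E j) (Set.Ici 0))
    (hd : ∀ j s, 0 < s → HasDerivAt (E j) (E' j s) s)
    (hle : ∀ j s, E' j s ≤ -2 * E (j + 1) s + C j * ∑ l ∈ Finset.range j, E (l + 1) s)
    (τ : ℝ) (hτ : 0 < τ) :
    ∑ j ∈ Finset.range (k + 1), E j τ ≤ (k + 1 + ∑ i ∈ Finset.range (k + 1), C i) ^ k
      * (2 * max τ⁻¹ 1) ^ (k - m) * ∑ j ∈ Finset.range (m + 1), E j 0 := by
  have hanti := antitoneOn_weighted_energy k m E E' C hC hE hcont hd hle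
    Set.self_mem_Ici (Set.mem_Ici.2 hτ.le) hτ.le
  beta_reduce at hanti
  set M : ℝ := k + 1 + ∑ i ∈ Finset.range (k + 1), C i with hM
  have hCs : 0 ≤ ∑ i ∈ Finset.range (k + 1), C i := Finset.sum_nonneg fun i _ => hC i
  have hM1 : 1 ≤ M := by
    have : (0 : ℝ) ≤ k := k.cast_nonneg
    linarith
  have hθ0 : 0 < τ / (1 + τ) := by positivity
  have hθ1 : τ / (1 + τ) ≤ 1 := (div_le_one (by positivity)).2 (by linarith)
  have hθX : 1 ≤ (2 * max τ⁻¹ 1) * (τ / (1 + τ)) := by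
    rw [← mul_div_assoc, le_div_iff₀ (by positivity)]
    have h1 : 1 ≤ max τ⁻¹ 1 * τ := by
      calc 1 = τ⁻¹ * τ := (inv_mul_cancel₀ hτ.ne').symm
        _ ≤ _ := mul_le_mul_of_nonneg_right (le_max_left _ _) hτ.le
    have h2 : τ ≤ max τ⁻¹ 1 * τ := le_mul_of_one_le_left hτ.le (le_max_right _ _)
    linarith
  have hlow : (τ / (1 + τ)) ^ (k - m) * ∑ j ∈ Finset.range (k + 1), E j τ ≤
      ∑ j ∈ Finset.range (k + 1), M ^ (k - j) * (τ / (1 + τ)) ^ (j - m) * E j τ := by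
    rw [Finset.mul_sum]
    refine Finset.sum_le_sum fun j hj => mul_le_mul_of_nonneg_right ?_ (hE _ _)
    have hjk : j ≤ k := Nat.lt_succ_iff.1 (Finset.mem_range.1 hj)
    calc (τ / (1 + τ)) ^ (k - m) ≤ (τ / (1 + τ)) ^ (j - m) :=
          pow_le_pow_of_le_one hθ0.le hθ1 (by omega)
      _ ≤ _ := le_mul_of_one_le_left (by positivity) (one_le_pow₀ hM1)
  have hup : ∑ j ∈ Finset.range (k + 1), M ^ (k - j) * ((0 : ℝ) / (1 + 0)) ^ (j - m) * E j 0 ≤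
      M ^ k * ∑ j ∈ Finset.range (m + 1), E j 0 := by
    have hsub : Finset.range (m + 1) ⊆ Finset.range (k + 1) :=
      Finset.range_subset_range.2 (by omega)
    rw [← Finset.sum_subset hsub fun j _ hj => ?_, Finset.mul_sum]
    · refine Finset.sum_le_sum fun j hj => mul_le_mul_of_nonneg_right ?_ (hE _ _)
      have : j - m = 0 := by have := Finset.mem_range.1 hj; omega
      rw [this, pow_zero, mul_one]
      exact pow_le_pow_right₀ hM1 (by omega)
    · have : j - m ≠ 0 := by have := mt Finset.mem_range.2 hj; omega
      simp [this]
  have hS : 0 ≤ ∑ j ∈ Finset.range (k + 1), E j τ := Finset.sum_nonneg fun j _ => hE _ _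
  calc ∑ j ∈ Finset.range (k + 1), E j τ
      ≤ ((2 * max τ⁻¹ 1) * (τ / (1 + τ))) ^ (k - m) * ∑ j ∈ Finset.range (k + 1), E j τ :=
        le_mul_of_one_le_left hS (one_le_pow₀ hθX)
    _ = (2 * max τ⁻¹ 1) ^ (k - m)
        * ((τ / (1 + τ)) ^ (k - m) * ∑ j ∈ Finset.range (k + 1), E j τ) := by
        rw [mul_pow]; ring
    _ ≤ (2 * max τ⁻¹ 1) ^ (k - m) * (M ^ k * ∑ j ∈ Finset.range (m + 1), E j 0) :=
        mul_le_mul_of_nonneg_left ((hlow.trans hanti).trans hup) (by positivity)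
    _ = _ := by ring

/-- The components of a smooth compactly supported field as Schwartz functions. -/
def schComp (U : E3 → E3) (hU : ContDiff ℝ (⊤ : ℕ∞) U) (hUc : HasCompactSupport U) (i : Fin 3) :
    Sch :=
  (hUc.comp_left (g := fun y : E3 => y i) rfl).toSchwartzMap
    ((EuclideanSpace.proj i : E3 →L[ℝ] ℝ).contDiff.comp hU)

lemma schL_schComp_apply (U : E3 → E3) (hU : ContDiff ℝ (⊤ : ℕ∞) U) (hUc : HasCompactSupport U)
    (f : Sch) (x : E3) : schL (schComp U hU hUc) f x = Lgen U f x := by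
  rw [schL_apply, Lgen]
  simp only [add_apply, sub_apply, smul_apply, sum_apply, smul_eq_mul,
    schMul_apply (coord_hasTemperateGrowth _), schMul_apply (schComp U hU hUc _).hasTemperateGrowth,
    schD_apply]
  rfl

/-- The time slices of an admissible solution form a differentiable curve of Schwartz functions. -/
lemma IsAdmissibleSS.exists_schEvol {U : E3 → E3} (hU : ContDiff ℝ (⊤ : ℕ∞) U)
    (hUc : HasCompactSupport U) {Θ : E3 → ℝ → ℝ} (hΘ : IsAdmissibleSS U (Set.Ici 0) Θ) :
    ∃ F : ℝ → Sch, (∀ s, 0 ≤ s → (F s : E3 → ℝ) = fun x => Θ x s) ∧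
      SchEvol F (fun s => schL (schComp U hU hUc) (F s)) := by
  obtain ⟨hsm, hpde, hdec⟩ := hΘ
  have hslice : ∀ s, 0 ≤ s → ContDiff ℝ (⊤ : ℕ∞) (fun x => Θ x s) := fun s hs => by
    rw [← contDiffOn_univ]
    exact hsm.comp (f := fun x : E3 => (x, s)) (by fun_prop) fun x _ => hs
  have hexists : ∀ s : ℝ, ∃ f : Sch, 0 ≤ s → (f : E3 → ℝ) = fun x => Θ x s := fun s => by
    by_cases hs : 0 ≤ s
    · refine ⟨⟨fun x => Θ x s, hslice s hs, fun n k => ?_⟩, fun _ => rfl⟩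
      obtain ⟨C, hC⟩ := hdec n k s s
      exact ⟨C, fun x => hC x s hs le_rfl le_rfl⟩
    · exact ⟨0, fun h => absurd h hs⟩
  choose F hF using hexists
  have hset : (Set.univ : Set E3) ×ˢ Set.Ici (0 : ℝ) = {q : E3 × ℝ | q.2 ∈ Set.Ici 0} := by
    ext q; simp
  have hbdd : ∀ b, Bornology.IsVonNBounded ℝ (F '' Set.Icc 0 b) := fun b => by
    rw [(schwartz_withSeminorms ℝ E3 ℝ).image_isVonNBounded_iff_seminorm_bounded]
    rintro ⟨n, k⟩
    obtain ⟨C, hC⟩ := hdec n k 0 b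
    refine ⟨|C| + 1, by positivity, fun s hs => lt_of_le_of_lt ?_ (lt_add_one |C|)⟩
    refine SchwartzMap.seminorm_le_bound ℝ n k (F s) (abs_nonneg C) fun x => ?_
    rw [hF s hs.1]
    exact (hC x s hs.1 hs.1 hs.2).trans (le_abs_self C)
  refine ⟨F, hF, ⟨?_, fun s hs x => ?_, hbdd, fun b => ?_⟩⟩
  · rw [hset]
    exact hsm.congr fun q hq => congrFun (hF q.2 hq) q.1
  · have hd : DifferentiableAt ℝ (fun t => Θ x t) s := by
      have hmem : {q : E3 × ℝ | q.2 ∈ Set.Ici 0} ∈ nhds (x, s) := by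
        rw [← hset]
        exact prod_mem_nhds Filter.univ_mem (Ici_mem_nhds hs)
      exact ((hsm.contDiffAt hmem).differentiableAt (by simp)).comp s
        (f := fun t : ℝ => (x, t)) (by fun_prop)
    have h1 := hd.hasDerivAt
    rw [hpde x s hs.le, ← hF s hs.le] at h1
    rw [schL_schComp_apply]
    refine h1.congr_of_eventuallyEq ?_
    filter_upwards [Ioi_mem_nhds hs] with t ht
    exact congrFun (hF t (le_of_lt ht)) x
  · simpa only [Set.image_image] using (hbdd b).image (schL (schComp U hU hUc))

lemma max_inv_one_pow_le (n : ℕ) (τ : ℝ) (hτ : 0 < τ) :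
    (max τ⁻¹ 1) ^ n ≤ (max (τ ^ (-((n : ℝ) / 2))) 1) ^ 2 := by
  rcases max_choice τ⁻¹ 1 with h | h <;> rw [h]
  · have : τ⁻¹ ^ n = (τ ^ (-((n : ℝ) / 2))) ^ 2 := by
      rw [← Real.rpow_natCast (τ ^ (-((n : ℝ) / 2))), ← Real.rpow_mul hτ.le, inv_pow,
        ← Real.rpow_natCast τ n, ← Real.rpow_neg hτ.le]
      congr 1
      push_cast
      ring
    rw [this]
    gcongr
    exact le_max_left _ _
  · rw [one_pow]
    exact one_le_pow₀ (le_max_right _ _)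

lemma sobSq_le_sum_sobPair (k : ℕ) (f : Sch) :
    sobSq k f ≤ 3 ^ k * ∑ j ∈ Finset.range (k + 1), sobPair j f f := by
  rw [sobSq, Finset.mul_sum]
  refine Finset.sum_le_sum fun j hj => (integral_le_sobPair_self j f).trans ?_
  exact mul_le_mul_of_nonneg_right (pow_le_pow_right₀ (by norm_num)
    (Nat.lt_succ_iff.1 (Finset.mem_range.1 hj))) (sobPair_self_nonneg j f)

lemma sum_sobPair_le_sobSq (k : ℕ) (f : Sch) :
    ∑ j ∈ Finset.range (k + 1), sobPair j f f ≤ 3 ^ k * sobSq k f := by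
  rw [sobSq, Finset.mul_sum]
  refine Finset.sum_le_sum fun j hj => (sobPair_self_le_integral j f).trans ?_
  exact mul_le_mul_of_nonneg_right (pow_le_pow_right₀ (by norm_num)
    (Nat.lt_succ_iff.1 (Finset.mem_range.1 hj))) (integral_nonneg fun x => by positivity)

/-- **Parabolic regularity estimate for the semigroup `e^{τL}`** generated by
`L = Δ + ½(1+ξ·∇) − Ū·∇`.  For all integers `k ≥ m ≥ 0` there exists `C = C(k,m,Ū)` such
that any admissible solution of `∂_τΘ = LΘ` on `[0,∞)` satisfies
`‖Θ(τ)‖_{H^k} ≤ C max{τ^{−(k−m)/2}, 1} ‖Θ(0)‖_{H^m}` for all `τ > 0`. -/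
theorem selfSimilar_drift_diffusion_smoothing
    (Ubar : E3 → E3) (hU : ContDiff ℝ (⊤ : ℕ∞) Ubar) (hUc : HasCompactSupport Ubar)
    (hUdiv : ∀ x, divg Ubar x = 0) :
    ∀ k m : ℕ, m ≤ k → ∃ C : ℝ,
      ∀ Θ : E3 → ℝ → ℝ, IsAdmissibleSS Ubar (Set.Ici 0) Θ →
        ∀ τ : ℝ, 0 < τ →
          Real.sqrt (sobSq k (fun ξ => Θ ξ τ))
            ≤ C * max (τ ^ (-(((k : ℝ) - (m : ℝ)) / 2))) 1
              * Real.sqrt (sobSq m (fun ξ => Θ ξ 0)) := by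
  intro k m hmk
  set u := schComp Ubar hU hUc with hu
  choose C hC0 hC using sobPair_schL_le u hUdiv
  set M : ℝ := k + 1 + ∑ i ∈ Finset.range (k + 1), 2 * C i with hM
  have hM0 : 0 ≤ M := by
    have := Finset.sum_nonneg fun i (_ : i ∈ Finset.range (k + 1)) =>
      mul_nonneg zero_le_two (hC0 i)
    positivity
  refine ⟨Real.sqrt (3 ^ k * (M ^ k * 2 ^ (k - m) * 3 ^ m)), fun Θ hΘ τ hτ => ?_⟩
  obtain ⟨F, hF, hev⟩ := hΘ.exists_schEvol hU hUc
  have hsum := sum_energy_le k m hmk (fun j s => sobPair j (F s) (F s))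
    (fun j s => 2 * sobPair j (F s) (schL u (F s))) (fun j => 2 * C j)
    (fun j => mul_nonneg zero_le_two (hC0 j)) (fun j s => sobPair_self_nonneg j (F s))
    (fun j => hev.continuousOn_sobPair j) (fun j s hs => hev.hasDerivAt_sobPair j s hs)
    (fun j s => by linarith [hC j (F s)]) τ hτ
  beta_reduce at hsum
  rw [← hM, mul_pow] at hsum
  rw [← hF τ hτ.le, ← hF 0 le_rfl]
  have hX := max_inv_one_pow_le (k - m) τ hτ
  rw [Nat.cast_sub hmk] at hX
  set Y : ℝ := max (τ ^ (-(((k : ℝ) - (m : ℝ)) / 2))) 1 with hY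
  have hY0 : 0 ≤ Y := zero_le_one.trans (le_max_right _ _)
  have hmain : sobSq k (F τ) ≤
      (3 ^ k * (M ^ k * 2 ^ (k - m) * 3 ^ m)) * Y ^ 2 * sobSq m (F 0) := by
    have hS : 0 ≤ sobSq m (F 0) :=
      Finset.sum_nonneg fun j _ => integral_nonneg fun x => by positivity
    calc sobSq k (F τ) ≤ 3 ^ k * ∑ j ∈ Finset.range (k + 1), sobPair j (F τ) (F τ) :=
          sobSq_le_sum_sobPair k (F τ)
      _ ≤ 3 ^ k * (M ^ k * (2 ^ (k - m) * max τ⁻¹ 1 ^ (k - m))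
            * ∑ j ∈ Finset.range (m + 1), sobPair j (F 0) (F 0)) := by gcongr
      _ ≤ 3 ^ k * (M ^ k * (2 ^ (k - m) * Y ^ 2) * (3 ^ m * sobSq m (F 0))) := by
          gcongr
          · exact Finset.sum_nonneg fun j _ => sobPair_self_nonneg j (F 0)
          · exact sum_sobPair_le_sobSq m (F 0)
      _ = _ := by ring
  calc Real.sqrt (sobSq k (F τ)) ≤ _ := Real.sqrt_le_sqrt hmain
    _ = _ := by
      rw [Real.sqrt_mul (by positivity), Real.sqrt_mul (by positivity), Real.sqrt_sq hY0]
end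
end
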